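/- arXiv:1311.0365 — 3 statements merged into one kernel-verified Lean document; each statement's English description precedes it below -/
import Mathlib

section
/- Let x_{n,1} ≤ … ≤ x_{n,n} denote the (real, positive) zeros of the rescaled polynomial x ↦ F_n(n^r x), and let μ_n = (1/n) Σ_{k=1}^n δ_{x_{n,k}} be the normalized zero counting measure. Then the sequence (μ_n) converges weakly, as n → ∞, to the probability measure μ on ℝ whose cumulative distribution function is V. -/
open Real MeasureTheory Filter Polynomial
open scoped ENNReal

/-- A real combination of a real-rooted polynomial and its derivative is real-rooted. -/
lemma splits_derivative_add_C_mul {q : ℝ[X]} (hq : q.Splits) (a : ℝ) :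
    (derivative q + C a * q).Splits := by
  rcases eq_or_ne q 0 with rfl | hq0
  · simp
  refine Splits.of_splits_map (algebraMap ℝ ℂ) (IsAlgClosed.splits _) fun z hz => ?_
  by_contra hzr
  have hz0 := isRoot_of_mem_roots hz
  have him : z.im ≠ 0 := fun h => hzr ⟨z.re, by apply Complex.ext <;> simp [h]⟩
  set Q := q.map (algebraMap ℝ ℂ) with hQ
  have hQs : Q.Splits := hq.map _
  have hQz : Q.eval z ≠ 0 := fun h => hzr (hq.mem_range_of_isRoot hq0 h)
  have hderiv : Q.derivative.eval z = -a * Q.eval z := by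
    have := hz0.eq_zero
    simp only [Polynomial.map_add, Polynomial.map_mul, map_C, eval_add, eval_mul,
      eval_C, Complex.coe_algebraMap, ← hQ] at this
    rw [← derivative_map, ← hQ] at this
    linear_combination this
  have hsum := hQs.eval_derivative_div_eval_of_ne_zero hQz
  rw [hderiv, mul_div_cancel_right₀ _ hQz, hq.roots_map, Multiset.map_map] at hsum
  have hsum' := congrArg Complex.im hsum
  rw [← Complex.imLm_coe, map_multiset_sum, Multiset.map_map] at hsum'
  have hterm : ∀ x : ℝ, (1 / (z - (x : ℂ))).im = -z.im * (Complex.normSq (z - x))⁻¹ := by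
    intro x
    simp [Complex.inv_im, div_eq_mul_inv]
  have hpos : ∀ x : ℝ, 0 < (Complex.normSq (z - x))⁻¹ := by
    intro x
    refine inv_pos.2 (Complex.normSq_pos.2 fun h => him ?_)
    simpa using congrArg Complex.im h
  have h0 : (q.roots.map fun x : ℝ => (Complex.normSq (z - x))⁻¹).sum = 0 := by
    have : -z.im * (q.roots.map fun x : ℝ => (Complex.normSq (z - x))⁻¹).sum = 0 := by
      rw [← Multiset.sum_map_mul_left]
      simp only [Complex.imLm_coe, Function.comp_def, Complex.coe_algebraMap, hterm] at hsum'
      exact hsum'.symm.trans (by simp)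
    simpa [him] using this
  have hroots : q.roots = 0 := by
    by_contra hne
    obtain ⟨x, hx⟩ := Multiset.exists_mem_of_ne_zero hne
    refine absurd h0 (ne_of_gt ?_)
    rw [← Multiset.cons_erase hx, Multiset.map_cons, Multiset.sum_cons]
    refine add_pos_of_pos_of_nonneg (hpos x) (Multiset.sum_nonneg fun y hy => ?_)
    obtain ⟨w, -, rfl⟩ := Multiset.mem_map.1 hy
    exact (hpos w).le
  have hconst : q = C q.leadingCoeff := by simpa [hroots] using hq.eq_prod_roots
  rw [hroots] at hsum
  have ha : a = 0 := by simpa using hsum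
  rw [hconst, ha] at hz
  simp at hz

/-- The Hermite–Poulain theorem. -/
lemma splits_aeval_derivative {p q : ℝ[X]} (hp : p.Splits) (hq : q.Splits) :
    (aeval (derivative : ℝ[X] →ₗ[ℝ] ℝ[X]) p q).Splits := by
  induction hp using Submonoid.closure_induction generalizing q with
  | mem x hx =>
    rcases hx with ⟨a, rfl⟩ | ⟨a, rfl⟩
    · simpa [Module.algebraMap_end_apply, smul_eq_C_mul] using (Splits.C a).mul hq
    · simpa [Module.algebraMap_end_apply, smul_eq_C_mul] using splits_derivative_add_C_mul hq a
  | one => simpa using hq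
  | mul x y _ _ hx hy => simpa using hx (hy hq)

lemma splits_reverse {p : ℝ[X]} (hp : p.Splits) : p.reverse.Splits := by
  induction hp using Submonoid.closure_induction with
  | mem x hx =>
    rcases hx with ⟨a, rfl⟩ | ⟨a, rfl⟩
    · simp
    · refine Splits.of_natDegree_le_one ((reverse_natDegree_le _).trans ?_)
      simp
  | one => simp [← C_1, -map_one]
  | mul x y _ _ hx hy => simpa using hx.mul hy

lemma natDegree_sum_range_C_mul_X_pow {n : ℕ} {c : ℕ → ℝ} (hc : c n ≠ 0) :
    (∑ k ∈ Finset.range (n + 1), C (c k) * X ^ k).natDegree = n := by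
  refine natDegree_eq_of_le_of_coeff_ne_zero (natDegree_sum_le_of_forall_le _ _ fun k hk => ?_) ?_
  · exact (natDegree_C_mul_X_pow_le _ _).trans (by simpa [Nat.lt_succ_iff] using hk)
  · simpa [coeff_C_mul, coeff_X_pow] using hc

lemma coeff_sum_range_C_mul_X_pow {n : ℕ} {c : ℕ → ℝ} {k : ℕ} (hk : k ≤ n) :
    (∑ k ∈ Finset.range (n + 1), C (c k) * X ^ k).coeff k = c k := by
  simp [coeff_C_mul, coeff_X_pow, hk]

/-- The sequence `1 / (k + a)!` is a multiplier sequence. -/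
lemma splits_sum_div_factorial {n : ℕ} {c : ℕ → ℝ} (hc : c n ≠ 0) (a : ℕ)
    (h : (∑ k ∈ Finset.range (n + 1), C (c k) * X ^ k).Splits) :
    (∑ k ∈ Finset.range (n + 1), C (c k / ((k + a).factorial : ℝ)) * X ^ k).Splits := by
  set P : ℝ[X] := ∑ k ∈ Finset.range (n + 1), C (c k) * X ^ k with hP
  set T : ℝ[X] := ∑ k ∈ Finset.range (n + 1), C (c k / ((k + a).factorial : ℝ)) * X ^ k with hT
  have hdeg : P.natDegree = n := natDegree_sum_range_C_mul_X_pow hc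
  have key : aeval (derivative : ℝ[X] →ₗ[ℝ] ℝ[X]) P.reverse (X ^ (n + a)) =
      C ((n + a).factorial : ℝ) * X ^ a * T := by
    rw [aeval_eq_sum_range' (Nat.lt_succ_of_le ((reverse_natDegree_le P).trans hdeg.le)),
      ← Finset.sum_range_reflect, hT, Finset.mul_sum, LinearMap.sum_apply]
    refine Finset.sum_congr rfl fun k hk => ?_
    have hkn : k ≤ n := by simpa [Nat.lt_succ_iff] using hk
    have h1 : n.succ - 1 - k = n - k := by simp
    have h2 : n + a - (n - k) = a + k := by omega
    rw [h1, coeff_reverse, hdeg, revAt_le (Nat.sub_le _ _), Nat.sub_sub_self hkn,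
      hP, coeff_sum_range_C_mul_X_pow hkn, LinearMap.smul_apply, Module.End.pow_apply,
      iterate_derivative_X_pow_eq_C_mul, h2, smul_eq_C_mul]
    have h3 : (((n + a).descFactorial (n - k) : ℕ) : ℝ) =
        (n + a).factorial / (k + a).factorial := by
      rw [eq_div_iff (by positivity), Nat.descFactorial_eq_div (by omega), h2, add_comm a k,
        Nat.cast_div (Nat.factorial_dvd_factorial (by omega)) (by positivity)]
      field_simp
    rw [h3, pow_add]
    have h4 : C (c k) * C (((n + a).factorial : ℝ) / (k + a).factorial) =
      C ((n + a).factorial : ℝ) * C (c k / ((k + a).factorial : ℝ)) := by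
      rw [← C_mul, ← C_mul]; congr 1; ring
    linear_combination X ^ a * X ^ k * h4
  have hT0 : T ≠ 0 := by
    intro h0
    have := coeff_sum_range_C_mul_X_pow (c := fun k => c k / ((k + a).factorial : ℝ)) (le_refl n)
    rw [← hT, h0, coeff_zero] at this
    exact (div_ne_zero hc (by positivity)) this.symm
  have hs := splits_aeval_derivative (splits_reverse h) (q := X ^ (n + a)) (Splits.X.pow _)
  rw [key] at hs
  refine hs.of_dvd (mul_ne_zero (mul_ne_zero ?_ (pow_ne_zero _ X_ne_zero)) hT0)
    (dvd_mul_left _ _)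
  exact C_ne_zero.2 (by positivity)

lemma splits_hypergeometric (n : ℕ) (l : List ℕ) :
    (∑ k ∈ Finset.range (n + 1), C ((-1 : ℝ) ^ k * (n.choose k : ℝ) /
      (l.map fun a => ((k + a).factorial : ℝ)).prod) * X ^ k).Splits := by
  induction l with
  | nil =>
    have : (∑ k ∈ Finset.range (n + 1), C ((-1 : ℝ) ^ k * (n.choose k : ℝ) /
        (([] : List ℕ).map fun a => ((k + a).factorial : ℝ)).prod) * X ^ k) =
        (C (-1) * X + C 1) ^ n := by
      rw [add_pow]
      refine Finset.sum_congr rfl fun k _ => ?_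
      simp
      ring
    rw [this]
    exact (Splits.of_natDegree_le_one (natDegree_linear_le)).pow n
  | cons a l ih =>
    have h0 : (-1 : ℝ) ^ n * (n.choose n : ℝ) /
        (l.map fun a => ((n + a).factorial : ℝ)).prod ≠ 0 := by
      refine div_ne_zero (by simp) (List.prod_ne_zero ?_)
      simp [Nat.factorial_ne_zero]
    convert splits_sum_div_factorial
      (c := fun k => (-1 : ℝ) ^ k * (n.choose k : ℝ) /
        (l.map fun a => ((k + a).factorial : ℝ)).prod) h0 a ih using 4 with k hk
    rw [List.map_cons, List.prod_cons, div_div, mul_comm (List.prod _)]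

/-- The Raney (two-parameter Fuss–Catalan) numbers `x / (x + (r + 1) k) * choose (x + (r + 1) k) k`,
written without division. -/
def raney (r : ℕ) : ℕ → ℕ → ℝ
  | 0, _ => 1
  | k + 1, x => ((x + (r + 1) * k + r).choose (k + 1) : ℝ) -
      r * ((x + (r + 1) * k + r).choose k : ℝ)

lemma raney_succ_zero (r k : ℕ) : raney r (k + 1) 0 = 0 := by
  have h := Nat.choose_succ_right_eq ((r + 1) * k + r) k
  have h2 : (r + 1) * k + r - k = r * (k + 1) := by
    rw [show (r + 1) * k + r = r * (k + 1) + k by ring, Nat.add_sub_cancel]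
  rw [h2, ← mul_assoc] at h
  have h3 := Nat.eq_of_mul_eq_mul_right (Nat.succ_pos k) h
  simp only [raney, zero_add, h3]
  push_cast
  ring

lemma raney_succ_succ (r k x : ℕ) :
    raney r (k + 1) (x + 1) = raney r (k + 1) x + raney r k (x + (r + 1)) := by
  cases k with
  | zero =>
    simp only [raney, mul_zero, add_zero, zero_add, Nat.choose_one_right, Nat.choose_zero_right]
    push_cast
    ring
  | succ k =>
    have e1 : x + 1 + (r + 1) * (k + 1) + r = x + (r + 1) * (k + 1) + r + 1 := by ring
    have e2 : x + (r + 1) + (r + 1) * k + r = x + (r + 1) * (k + 1) + r := by ring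
    simp only [raney, e1, e2, Nat.choose_succ_succ']
    push_cast
    ring

/-- The generating function of the Raney numbers. -/
def raneySeries (r x : ℕ) : PowerSeries ℝ := PowerSeries.mk fun k => raney r k x

lemma raneySeries_zero (r : ℕ) : raneySeries r 0 = 1 := by
  ext k
  cases k with
  | zero => simp [raneySeries, raney]
  | succ k => simp [raneySeries, raney_succ_zero, PowerSeries.coeff_one]

lemma raneySeries_succ (r x : ℕ) :
    raneySeries r (x + 1) = raneySeries r x + PowerSeries.X * raneySeries r (x + (r + 1)) := by
  ext k
  cases k with
  | zero => simp [raneySeries, raney]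
  | succ k => simp [raneySeries, raney_succ_succ, PowerSeries.coeff_succ_X_mul]

lemma eq_zero_of_add_one_eq_add_X_mul {m : ℕ} {d : ℕ → PowerSeries ℝ} (h0 : d 0 = 0)
    (h : ∀ x, d (x + 1) = d x + PowerSeries.X * d (x + m)) (x : ℕ) : d x = 0 := by
  have key : ∀ k x, PowerSeries.coeff k (d x) = 0 := by
    intro k
    induction k with
    | zero =>
      intro x
      induction x with
      | zero => simp [h0]
      | succ x ih => rw [h, map_add, ih]; simp
    | succ k ihk =>
      intro x
      induction x with
      | zero => simp [h0]
      | succ x ih => rw [h, map_add, ih, PowerSeries.coeff_succ_X_mul, ihk, add_zero]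
  ext k
  simpa using key k x

lemma raneySeries_add (r x y : ℕ) :
    raneySeries r (x + y) = raneySeries r x * raneySeries r y := by
  refine sub_eq_zero.1 (eq_zero_of_add_one_eq_add_X_mul (m := r + 1)
    (d := fun x => raneySeries r (x + y) - raneySeries r x * raneySeries r y) ?_ ?_ x)
  · simp [raneySeries_zero]
  · intro x
    have e : x + (r + 1) + y = x + y + (r + 1) := by ring
    simp only [add_right_comm x 1 y, raneySeries_succ, e]
    ring

lemma raneySeries_eq_pow (r x : ℕ) : raneySeries r x = raneySeries r 1 ^ x := by
  induction x with
  | zero => simp [raneySeries_zero]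
  | succ x ih => rw [raneySeries_add, ih, pow_succ]

lemma raneySeries_one_eq (r : ℕ) :
    raneySeries r 1 = 1 + PowerSeries.X * raneySeries r 1 ^ (r + 1) := by
  rw [← raneySeries_eq_pow]
  simpa [raneySeries_zero] using raneySeries_succ r 0

/-- The operator that, through multiplication by `Q` with `n Q - X Q' = n H Q`, corresponds to
`(n + a - X d/dX) / n`. -/
noncomputable def riccatiStep (n : ℕ) (H : PowerSeries ℝ) (a : ℕ) (f : PowerSeries ℝ) :
    PowerSeries ℝ :=
  H * f + PowerSeries.C ((a : ℝ) / n) * f -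
    PowerSeries.C (1 / (n : ℝ)) * (PowerSeries.X * PowerSeries.derivative ℝ f)

lemma coeff_X_mul_derivative (f : PowerSeries ℝ) (k : ℕ) :
    PowerSeries.coeff k (PowerSeries.X * PowerSeries.derivative ℝ f) =
      k * PowerSeries.coeff k f := by
  cases k with
  | zero => simp
  | succ k =>
    rw [PowerSeries.coeff_succ_X_mul, PowerSeries.coeff_derivative]
    push_cast
    ring

lemma tendsto_coeff_riccatiStep {H f : ℕ → PowerSeries ℝ} {H₀ f₀ : PowerSeries ℝ} {k : ℕ}
    (hH : ∀ i ≤ k, Tendsto (fun n => PowerSeries.coeff i (H n)) atTop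
      (nhds (PowerSeries.coeff i H₀)))
    (hf : ∀ i ≤ k, Tendsto (fun n => PowerSeries.coeff i (f n)) atTop
      (nhds (PowerSeries.coeff i f₀))) (a : ℕ) :
    ∀ i ≤ k, Tendsto (fun n => PowerSeries.coeff i (riccatiStep n (H n) a (f n))) atTop
      (nhds (PowerSeries.coeff i (H₀ * f₀))) := by
  intro i hi
  have h1 : Tendsto (fun n => PowerSeries.coeff i (H n * f n)) atTop
      (nhds (PowerSeries.coeff i (H₀ * f₀))) := by
    simp only [PowerSeries.coeff_mul]
    refine tendsto_finsetSum _ fun p hp => ?_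
    have hp' := Finset.HasAntidiagonal.mem_antidiagonal.1 hp
    exact (hH _ (by omega)).mul (hf _ (by omega))
  have h2 : Tendsto (fun n : ℕ => (a : ℝ) / n * PowerSeries.coeff i (f n)) atTop (nhds 0) := by
    simpa using (tendsto_const_div_atTop_nhds_zero_nat (a : ℝ)).mul (hf i hi)
  have h3 : Tendsto (fun n : ℕ => 1 / (n : ℝ) * (i * PowerSeries.coeff i (f n))) atTop
      (nhds 0) := by
    simpa using (tendsto_const_div_atTop_nhds_zero_nat (1 : ℝ)).mul
      ((hf i hi).const_mul (i : ℝ))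
  have h4 := (h1.add h2).sub h3
  simp only [add_zero, sub_zero] at h4
  refine h4.congr fun n => ?_
  simp only [riccatiStep, map_sub, map_add, PowerSeries.coeff_C_mul, coeff_X_mul_derivative]

lemma tendsto_coeff_of_riccati {l : List ℕ} {H : ℕ → PowerSeries ℝ}
    (h : ∀ n : ℕ, 1 ≤ n →
      H n = 1 + PowerSeries.X * l.foldr (riccatiStep n (H n)) (H n)) (k : ℕ) :
    Tendsto (fun n => PowerSeries.coeff k (H n)) atTop (nhds (raney l.length k 1)) := by
  have hc : ∀ i, raney l.length i 1 = PowerSeries.coeff i (raneySeries l.length 1) := by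
    simp [raneySeries]
  have hfold : ∀ (k : ℕ), (∀ i ≤ k, Tendsto (fun n => PowerSeries.coeff i (H n)) atTop
      (nhds (PowerSeries.coeff i (raneySeries l.length 1)))) → ∀ l' : List ℕ,
      ∀ i ≤ k, Tendsto (fun n => PowerSeries.coeff i (l'.foldr (riccatiStep n (H n)) (H n))) atTop
        (nhds (PowerSeries.coeff i (raneySeries l.length 1 ^ (l'.length + 1)))) := by
    intro k hk l'
    induction l' with
    | nil => simpa using hk
    | cons a l' ih =>
      simp only [List.foldr_cons, List.length_cons]
      rw [pow_succ']
      exact tendsto_coeff_riccatiStep hk ih a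
  rw [hc]
  induction k using Nat.strong_induction_on with
  | _ k ih =>
    rw [raneySeries_one_eq]
    cases k with
    | zero =>
      refine tendsto_const_nhds.congr' ?_
      filter_upwards [eventually_ge_atTop 1] with n hn
      rw [h n hn]
      simp
    | succ k =>
      rw [map_add, PowerSeries.coeff_succ_X_mul]
      have := hfold k (fun i hi => ih i (by omega)) l k le_rfl
      refine (this.const_add _).congr' ?_
      filter_upwards [eventually_ge_atTop 1] with n hn
      conv_rhs => rw [h n hn]
      rw [map_add, PowerSeries.coeff_succ_X_mul]

/-- The logarithmic derivative of a product of linear factors, multiplied out. -/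
lemma card_mul_prod_sub_X_mul_derivative (S : Multiset ℝ) :
    (PowerSeries.C (S.card : ℝ)) * (S.map fun x => 1 - PowerSeries.C x * PowerSeries.X).prod -
      PowerSeries.X * PowerSeries.derivative ℝ
        (S.map fun x => 1 - PowerSeries.C x * PowerSeries.X).prod =
      (S.map fun x : ℝ => PowerSeries.mk fun k => x ^ k).sum *
        (S.map fun x => 1 - PowerSeries.C x * PowerSeries.X).prod := by
  induction S using Multiset.induction_on with
  | empty => simp
  | cons a S ih =>
    have hgeom : (PowerSeries.mk fun k => a ^ k) * (1 - PowerSeries.C a * PowerSeries.X) = 1 := by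
      ext k
      cases k with
      | zero => simp
      | succ k =>
        rw [mul_sub, mul_one, mul_left_comm, map_sub, PowerSeries.coeff_C_mul,
          PowerSeries.coeff_succ_mul_X]
        simp [PowerSeries.coeff_one, pow_succ']
    simp only [Multiset.card_cons, Multiset.map_cons, Multiset.prod_cons, Multiset.sum_cons,
      Nat.cast_add, Nat.cast_one, map_add, map_one, Derivation.leibniz, map_sub, smul_eq_mul,
      PowerSeries.derivative_C, PowerSeries.derivative_X, Derivation.map_one_eq_zero]
    linear_combination (1 - PowerSeries.C a * PowerSeries.X) * ih -
      (S.map fun x => 1 - PowerSeries.C x * PowerSeries.X).prod * hgeom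

/-- The operator `n + a - X d/dX`. -/
noncomputable def eulerStep (n a : ℕ) (f : PowerSeries ℝ) : PowerSeries ℝ :=
  PowerSeries.C ((n : ℝ) + a) * f - PowerSeries.X * PowerSeries.derivative ℝ f

lemma coeff_eulerStep (n a i : ℕ) (f : PowerSeries ℝ) :
    PowerSeries.coeff i (eulerStep n a f) = ((n : ℝ) + a - i) * PowerSeries.coeff i f := by
  rw [eulerStep, map_sub, PowerSeries.coeff_C_mul, coeff_X_mul_derivative]
  ring

lemma coeff_foldr_eulerStep (n i : ℕ) (l : List ℕ) (f : PowerSeries ℝ) :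
    PowerSeries.coeff i (l.foldr (eulerStep n) f) =
      (l.map fun a : ℕ => (n : ℝ) + a - i).prod * PowerSeries.coeff i f := by
  induction l with
  | nil => simp
  | cons a l ih => simp [coeff_eulerStep, ih, mul_assoc]

lemma foldr_eulerStep_mul {n : ℕ} (hn : n ≠ 0) {Q H : PowerSeries ℝ}
    (hQ : eulerStep n 0 Q = PowerSeries.C (n : ℝ) * H * Q) (l : List ℕ) :
    l.foldr (eulerStep n) (eulerStep n 0 Q) =
      PowerSeries.C (n : ℝ) ^ (l.length + 1) * l.foldr (riccatiStep n H) H * Q := by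
  induction l with
  | nil => simpa using hQ
  | cons a l ih =>
    have hn' : (n : ℝ) ≠ 0 := Nat.cast_ne_zero.2 hn
    have h1 : PowerSeries.C (n : ℝ) * PowerSeries.C (1 / (n : ℝ)) = 1 := by
      rw [← map_mul, mul_one_div_cancel hn', map_one]
    have h2 : PowerSeries.C (n : ℝ) * PowerSeries.C ((a : ℝ) / n) = PowerSeries.C (a : ℝ) := by
      rw [← map_mul, mul_div_cancel₀ _ hn']
    have h3 : PowerSeries.derivative ℝ (PowerSeries.C (n : ℝ) ^ (l.length + 1)) = 0 := by
      rw [← map_pow, PowerSeries.derivative_C]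
    rw [List.foldr_cons, ih, List.foldr_cons, List.length_cons]
    simp only [eulerStep, riccatiStep, Derivation.leibniz, smul_eq_mul, h3, map_add,
      Nat.cast_zero, add_zero] at hQ ⊢
    set G := l.foldr (riccatiStep n H) H
    rw [pow_succ (PowerSeries.C (n : ℝ)) (l.length + 1)]
    set c := PowerSeries.C (n : ℝ) ^ (l.length + 1)
    linear_combination c * G * hQ - c * Q * G * h2 +
      c * Q * PowerSeries.X * PowerSeries.derivative ℝ G * h1

/-- The normalized power sums of the zeros of a polynomial whose coefficients satisfy a
hypergeometric recursion satisfy a Riccati type equation. -/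
lemma riccati_of_hypergeometric {n : ℕ} (hn : n ≠ 0) (l : List ℕ) {g : ℕ → ℝ}
    (hg : ∀ k < n, (l.map fun a : ℕ => (k : ℝ) + 1 + a).prod * (k + 1) * g (k + 1) =
      n ^ l.length * (k - n) * g k)
    {Q H : PowerSeries ℝ} {c : ℝ} (hc : c ≠ 0) (hQ0 : Q ≠ 0)
    (hQ : ∀ i, c * PowerSeries.coeff i Q = if i ≤ n then g (n - i) else 0)
    (hH : eulerStep n 0 Q = PowerSeries.C (n : ℝ) * H * Q) :
    H = 1 + PowerSeries.X * l.foldr (riccatiStep n H) H := by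
  have hn' : (n : ℝ) ≠ 0 := Nat.cast_ne_zero.2 hn
  have hode : PowerSeries.X * l.foldr (eulerStep n) (eulerStep n 0 Q) =
      PowerSeries.C (n : ℝ) ^ l.length * (eulerStep n 0 Q - PowerSeries.C (n : ℝ) * Q) := by
    ext i
    rw [← map_pow, PowerSeries.coeff_C_mul, map_sub, PowerSeries.coeff_C_mul, coeff_eulerStep]
    cases i with
    | zero => simp
    | succ i =>
      rw [PowerSeries.coeff_succ_X_mul, coeff_foldr_eulerStep, coeff_eulerStep]
      refine mul_left_cancel₀ hc ?_
      have h1 := hQ i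
      have h2 := hQ (i + 1)
      rcases lt_or_ge i n with hi | hi
      · rw [if_pos hi.le] at h1
        rw [if_pos (by omega)] at h2
        have h3 := hg (n - (i + 1)) (by omega)
        rw [show n - (i + 1) + 1 = n - i by omega, ← h1, ← h2, Nat.cast_sub (by omega)] at h3
        have h4 : (l.map fun a : ℕ => (n : ℝ) - ((i + 1 : ℕ) : ℝ) + 1 + a) =
            l.map fun a : ℕ => (n : ℝ) + a - i := by
          refine List.map_congr_left fun a _ => ?_
          push_cast
          ring
        rw [h4] at h3
        push_cast at h3 ⊢
        linear_combination h3
      · rw [if_neg (by omega)] at h2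
        have h3 : ((n : ℝ) - i) * (c * PowerSeries.coeff i Q) = 0 := by
          rcases hi.lt_or_eq with hi | rfl
          · rw [h1, if_neg (by omega), mul_zero]
          · simp
        push_cast
        linear_combination (l.map fun a : ℕ => (n : ℝ) + a - i).prod * h3 +
          (n : ℝ) ^ l.length * (i + 1) * h2
  rw [foldr_eulerStep_mul hn hH, hH] at hode
  have hcn : PowerSeries.C (n : ℝ) ^ (l.length + 1) * Q ≠ 0 :=
    mul_ne_zero (pow_ne_zero _ ((map_ne_zero_iff _ PowerSeries.C_injective).2 hn')) hQ0
  refine mul_left_cancel₀ hcn ?_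
  linear_combination -hode

lemma coe_reverse_prod_X_sub_C (S : Multiset ℝ) :
    (((S.map fun x => X - C x).prod.reverse : ℝ[X]) : PowerSeries ℝ) =
      (S.map fun x => 1 - PowerSeries.C x * PowerSeries.X).prod := by
  induction S using Multiset.induction_on with
  | empty => rw [Multiset.map_zero, Multiset.prod_zero, ← C_1, reverse_C, C_1]; simp
  | cons a S ih =>
    have : (X - C a : ℝ[X]).reverse = 1 - C a * X := by
      have hX : (X : ℝ[X]).reverse = 1 := by
        rw [← one_mul X, reverse_mul_X, ← C_1, reverse_C]
      rw [sub_eq_add_neg, ← C_neg, reverse_add_C, hX, natDegree_X, pow_one, C_neg, neg_mul,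
        sub_eq_add_neg]
    rw [Multiset.map_cons, Multiset.prod_cons, reverse_mul_of_domain, coe_mul, ih, this]
    simp

/-- Convergence of the normalized power sums of the zeros. -/
lemma tendsto_power_sums {l : List ℕ} {g : ℕ → ℕ → ℝ} (hg0 : ∀ n, g n n ≠ 0)
    (hg : ∀ n k : ℕ, k < n → (l.map fun a : ℕ => (k : ℝ) + 1 + a).prod * (k + 1) * g n (k + 1) =
      n ^ l.length * (k - n) * g n k)
    (hs : ∀ n, (∑ k ∈ Finset.range (n + 1), C (g n k) * X ^ k).Splits) (k : ℕ) :
    Tendsto (fun n : ℕ => (n : ℝ)⁻¹ *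
      ((∑ k ∈ Finset.range (n + 1), C (g n k) * X ^ k).roots.map (· ^ k)).sum) atTop
      (nhds (raney l.length k 1)) := by
  set G : ℕ → ℝ[X] := fun n => ∑ k ∈ Finset.range (n + 1), C (g n k) * X ^ k with hG
  set H : ℕ → PowerSeries ℝ := fun n => PowerSeries.C ((n : ℝ)⁻¹) *
    ((G n).roots.map fun x : ℝ => PowerSeries.mk fun k => x ^ k).sum with hH
  have hcoeff : ∀ n, PowerSeries.coeff k (H n) =
      (n : ℝ)⁻¹ * ((G n).roots.map (· ^ k)).sum := by
    intro n
    rw [hH, PowerSeries.coeff_C_mul, map_multiset_sum, Multiset.map_map]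
    simp
  refine (tendsto_coeff_of_riccati (l := l) (H := H) (fun n hn => ?_) k).congr hcoeff
  have hn0 : n ≠ 0 := by omega
  have hn' : (n : ℝ) ≠ 0 := Nat.cast_ne_zero.2 hn0
  have hdeg : (G n).natDegree = n := natDegree_sum_range_C_mul_X_pow (hg0 n)
  have hlead : (G n).leadingCoeff = g n n := by
    rw [leadingCoeff, hdeg]
    exact coeff_sum_range_C_mul_X_pow le_rfl
  have hcard : (G n).roots.card = n := by rw [← (hs n).natDegree_eq_card_roots, hdeg]
  have hrev := congrArg (fun p : ℝ[X] => (p.reverse : PowerSeries ℝ)) (hs n).eq_prod_roots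
  simp only [reverse_mul_of_domain, reverse_C, coe_mul, coe_C, coe_reverse_prod_X_sub_C] at hrev
  have hrev' : ((G n).reverse : PowerSeries ℝ) = PowerSeries.C (g n n) *
      ((G n).roots.map fun x => 1 - PowerSeries.C x * PowerSeries.X).prod := by
    rw [← hlead]; exact hrev
  refine riccati_of_hypergeometric hn0 l (hg n) (hg0 n) (Q := ((G n).roots.map fun x =>
    1 - PowerSeries.C x * PowerSeries.X).prod) ?_ (fun i => ?_) ?_
  · refine right_ne_zero_of_mul (a := PowerSeries.C (g n n)) ?_
    rw [← hrev', Ne, coe_eq_zero_iff, reverse_eq_zero]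
    exact fun h => hg0 n (by rw [← hlead, h, leadingCoeff_zero])
  · rw [← PowerSeries.coeff_C_mul, ← hrev', coeff_coe, coeff_reverse, hdeg]
    split_ifs with hi
    · rw [revAt_le hi]
      exact coeff_sum_range_C_mul_X_pow (Nat.sub_le _ _)
    · rw [revAt_eq_self_of_lt (by omega)]
      exact coeff_eq_zero_of_natDegree_lt (by omega)
  · have h1 := card_mul_prod_sub_X_mul_derivative (G n).roots
    rw [hcard] at h1
    have h2 : PowerSeries.C (n : ℝ) * PowerSeries.C ((n : ℝ)⁻¹) = 1 := by
      rw [← map_mul, mul_inv_cancel₀ hn', map_one]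
    simp only [eulerStep, Nat.cast_zero, add_zero, h1, hH, ← mul_assoc, h2, one_mul]

lemma sinc_pos {x : ℝ} (h0 : 0 ≤ x) (hx : x < π) : 0 < sinc x := by
  rcases h0.eq_or_lt with rfl | h0
  · simp
  · rw [sinc_of_ne_zero h0.ne']
    exact div_pos (sin_pos_of_pos_of_lt_pi h0 hx) h0

/-- The continuous extension of `sin φ / sin (r φ)` to `φ = 0`. -/
noncomputable def sinRatio (r : ℕ) (φ : ℝ) : ℝ := sinc φ / (r * sinc (r * φ))

/-- The boundary curve `sin φ / sin (r φ) * exp (i (r + 1) φ)`. -/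
noncomputable def fcCurve (r : ℕ) (φ : ℝ) : ℂ :=
  sinRatio r φ * Complex.exp (((r + 1) * φ : ℝ) * Complex.I)

/-- The continuous extension to `φ = 0` of `sin ((r + 1) φ) ^ (r + 1) / (sin φ * sin (r φ) ^ r)`. -/
noncomputable def fcRho (r : ℕ) (φ : ℝ) : ℝ :=
  (cos φ + cos (r * φ) * sinRatio r φ) ^ (r + 1) / sinRatio r φ

/-- The imaginary part of an antiderivative of `s ^ (m - 1)` along the curve `fcCurve r`. -/
noncomputable def fcPrim (r : ℕ) (m : ℤ) (φ : ℝ) : ℝ :=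
  if m = 0 then (r + 1) * φ else (fcCurve r φ ^ m).im / m

/-- The function `(r + 1) φ - r (sin ((r + 1) φ) / sin (r φ)) sin φ`. -/
noncomputable def fcAngle (r : ℕ) (φ : ℝ) : ℝ := fcPrim r 0 φ - r * fcPrim r 1 φ

section FussCatalan

variable {r : ℕ} {φ : ℝ}

lemma mul_lt_pi_of_mem_Icc (hφ : φ ∈ Set.Icc 0 (π / ((r : ℝ) + 1))) : (r : ℝ) * φ < π := by
  have h1 : φ * ((r : ℝ) + 1) ≤ π := (le_div_iff₀ (by positivity)).1 hφ.2
  rcases hφ.1.eq_or_lt with h | h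
  · rw [← h, mul_zero]; exact pi_pos
  · nlinarith

lemma sinRatio_pos (hr : 1 ≤ r) (hφ : φ ∈ Set.Icc 0 (π / ((r : ℝ) + 1))) :
    0 < sinRatio r φ := by
  have hr' : (1 : ℝ) ≤ r := by exact_mod_cast hr
  have h1 := mul_lt_pi_of_mem_Icc hφ
  have h2 : φ ≤ r * φ := le_mul_of_one_le_left hφ.1 hr'
  exact div_pos (sinc_pos hφ.1 (h2.trans_lt h1))
    (mul_pos (by linarith) (sinc_pos (by nlinarith [hφ.1]) h1))

lemma continuousOn_sinRatio (hr : 1 ≤ r) :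
    ContinuousOn (sinRatio r) (Set.Icc 0 (π / ((r : ℝ) + 1))) := by
  refine ContinuousOn.div continuous_sinc.continuousOn
    (continuous_const.mul (continuous_sinc.comp (continuous_const.mul continuous_id))).continuousOn
    fun φ hφ => ?_
  have hr' : (1 : ℝ) ≤ r := by exact_mod_cast hr
  exact (mul_pos (by linarith) (sinc_pos (by nlinarith [hφ.1]) (mul_lt_pi_of_mem_Icc hφ))).ne'

lemma sin_pos_of_mem_Ioo (hr : 1 ≤ r) (hφ : φ ∈ Set.Ioo 0 (π / ((r : ℝ) + 1))) :
    0 < sin φ ∧ 0 < sin (r * φ) ∧ 0 < sin ((r + 1) * φ) := by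
  have hr' : (1 : ℝ) ≤ r := by exact_mod_cast hr
  have h1 : φ * ((r : ℝ) + 1) < π := (lt_div_iff₀ (by positivity)).1 hφ.2
  have h0 := hφ.1
  refine ⟨sin_pos_of_pos_of_lt_pi h0 ?_, sin_pos_of_pos_of_lt_pi ?_ ?_,
    sin_pos_of_pos_of_lt_pi ?_ ?_⟩ <;> nlinarith

lemma sinRatio_eq (hr : 1 ≤ r) (h0 : φ ≠ 0) : sinRatio r φ = sin φ / sin (r * φ) := by
  have hr' : (r : ℝ) ≠ 0 := by positivity
  rw [sinRatio, sinc_of_ne_zero h0, sinc_of_ne_zero (mul_ne_zero hr' h0)]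
  field_simp

lemma cos_add_mul_sinRatio (hr : 1 ≤ r) (hφ : φ ∈ Set.Ioo 0 (π / ((r : ℝ) + 1))) :
    cos φ + cos (r * φ) * sinRatio r φ = sin ((r + 1) * φ) / sin (r * φ) := by
  have h := (sin_pos_of_mem_Ioo hr hφ).2.1.ne'
  rw [sinRatio_eq hr hφ.1.ne', add_mul, one_mul, sin_add]
  field_simp

lemma fcRho_eq (hr : 1 ≤ r) (hφ : φ ∈ Set.Ioo 0 (π / ((r : ℝ) + 1))) :
    fcRho r φ = sin ((r + 1) * φ) ^ (r + 1) / (sin φ * sin (r * φ) ^ r) := by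
  obtain ⟨h1, h2, h3⟩ := sin_pos_of_mem_Ioo hr hφ
  rw [fcRho, cos_add_mul_sinRatio hr hφ, sinRatio_eq hr hφ.1.ne', div_pow]
  field_simp
  ring

lemma fcRho_pos (hr : 1 ≤ r) (hφ : φ ∈ Set.Ioo 0 (π / ((r : ℝ) + 1))) : 0 < fcRho r φ := by
  obtain ⟨h1, h2, h3⟩ := sin_pos_of_mem_Ioo hr hφ
  rw [fcRho_eq hr hφ]
  positivity

lemma fcRho_zero (hr : 1 ≤ r) : fcRho r 0 = ((r : ℝ) + 1) ^ (r + 1) / (r : ℝ) ^ r := by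
  have hr' : (r : ℝ) ≠ 0 := by positivity
  have : 1 + 1 / (r : ℝ) = (r + 1) / r := by field_simp
  simp only [fcRho, sinRatio, mul_zero, sinc_zero, cos_zero, mul_one, one_mul, this]
  rw [div_pow]
  field_simp
  ring

lemma fcRho_end (hr : 1 ≤ r) : fcRho r (π / ((r : ℝ) + 1)) = 0 := by
  have hr1 : (r : ℝ) + 1 ≠ 0 := by positivity
  have hmem : π / ((r : ℝ) + 1) ∈ Set.Icc 0 (π / ((r : ℝ) + 1)) :=
    ⟨by positivity, le_rfl⟩
  have hpos := mul_lt_pi_of_mem_Icc hmem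
  have h0 : 0 < π / ((r : ℝ) + 1) := by positivity
  have hs : sin (r * (π / ((r : ℝ) + 1))) = sin (π / ((r : ℝ) + 1)) := by
    rw [← sin_pi_sub]
    congr 1
    field_simp
    ring
  have hc : cos (r * (π / ((r : ℝ) + 1))) = -cos (π / ((r : ℝ) + 1)) := by
    rw [← cos_pi_sub]
    congr 1
    field_simp
    ring
  have h1 : 0 < sin (r * (π / ((r : ℝ) + 1))) :=
    sin_pos_of_pos_of_lt_pi (by positivity) hpos
  rw [fcRho, sinRatio_eq hr h0.ne', hc, ← hs, div_self h1.ne']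
  simp

lemma continuousOn_fcRho (hr : 1 ≤ r) :
    ContinuousOn (fcRho r) (Set.Icc 0 (π / ((r : ℝ) + 1))) := by
  have h := continuousOn_sinRatio hr
  refine ContinuousOn.div ((ContinuousOn.add ?_ (ContinuousOn.mul ?_ h)).pow _) h
    fun φ hφ => (sinRatio_pos hr hφ).ne'
  · exact continuous_cos.continuousOn
  · exact (continuous_cos.comp (continuous_const.mul continuous_id)).continuousOn

lemma eventually_mem_Ioo (hφ : φ ∈ Set.Ioo 0 (π / ((r : ℝ) + 1))) :
    ∀ᶠ x in nhds φ, x ∈ Set.Ioo 0 (π / ((r : ℝ) + 1)) :=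
  isOpen_Ioo.mem_nhds hφ

lemma exists_hasDerivAt_fcRho (hr : 1 ≤ r) (hφ : φ ∈ Set.Ioo 0 (π / ((r : ℝ) + 1))) :
    ∃ d < 0, HasDerivAt (fcRho r) d φ := by
  obtain ⟨h1, h2, h3⟩ := sin_pos_of_mem_Ioo hr hφ
  have hd (c : ℝ) : HasDerivAt (fun x => sin (c * x)) (c * cos (c * φ)) φ := by
    have := ((hasDerivAt_id φ).const_mul c).sin
    simpa [mul_comm] using this
  have hD := ((hd (r + 1)).pow (r + 1)).div ((hasDerivAt_sin φ).mul ((hd r).pow r))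
    (mul_pos h1 (pow_pos h2 r)).ne'
  refine ⟨_, ?_, hD.congr_of_eventuallyEq ?_⟩
  · refine div_neg_of_neg_of_pos ?_ (pow_pos (mul_pos h1 (pow_pos h2 r)) 2)
    obtain ⟨t, rfl⟩ : ∃ t, r = t + 1 := ⟨r - 1, by omega⟩
    have hsin : sin (((t + 1 : ℕ) + 1 : ℝ) * φ) =
        sin ((t + 1 : ℕ) * φ) * cos φ + cos ((t + 1 : ℕ) * φ) * sin φ := by
      rw [add_mul, one_mul, sin_add]
    have hcos : cos (((t + 1 : ℕ) + 1 : ℝ) * φ) =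
        cos ((t + 1 : ℕ) * φ) * cos φ - sin ((t + 1 : ℕ) * φ) * sin φ := by
      rw [add_mul, one_mul, cos_add]
    have hsq1 := sin_sq_add_cos_sq φ
    have hsq2 := sin_sq_add_cos_sq ((t + 1 : ℕ) * φ)
    rw [hsin] at h3
    simp only [Pi.pow_apply, Pi.mul_apply, hsin, hcos, Nat.add_sub_cancel]
    set S := sin ((t + 1 : ℕ) * φ)
    set K := cos ((t + 1 : ℕ) * φ)
    set a := sin φ
    set b := cos φ
    push_cast
    have key : ((t : ℝ) + 1 + 1) ^ 2 * (K * b - S * a) * a * S -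
        (S * b + K * a) * (b * S + (t + 1) ^ 2 * K * a) < 0 := by
      have : ((t : ℝ) + 1 + 1) ^ 2 * (K * b - S * a) * a * S -
        (S * b + K * a) * (b * S + (t + 1) ^ 2 * K * a) =
        -((b * S - (t + 1) * K * a) ^ 2 + (t + 2) ^ 2 * (a * S) ^ 2) := by ring
      rw [this, neg_lt_zero]
      positivity
    have hmul : 0 < (S * b + K * a) ^ (t + 1) * S ^ t := by positivity
    refine lt_of_eq_of_lt ?_ (mul_neg_of_pos_of_neg hmul key)
    ring
  · filter_upwards [eventually_mem_Ioo hφ] with x hx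
    simpa using fcRho_eq hr hx

lemma strictAntiOn_fcRho (hr : 1 ≤ r) :
    StrictAntiOn (fcRho r) (Set.Icc 0 (π / ((r : ℝ) + 1))) := by
  refine strictAntiOn_of_deriv_neg (convex_Icc _ _) (continuousOn_fcRho hr) fun φ hφ => ?_
  rw [interior_Icc] at hφ
  obtain ⟨d, hd, h⟩ := exists_hasDerivAt_fcRho hr hφ
  rwa [h.deriv]

lemma fcCurve_ne_zero (hr : 1 ≤ r) (hφ : φ ∈ Set.Icc 0 (π / ((r : ℝ) + 1))) :
    fcCurve r φ ≠ 0 :=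
  mul_ne_zero (Complex.ofReal_ne_zero.2 (sinRatio_pos hr hφ).ne') (Complex.exp_ne_zero _)

lemma continuousOn_fcPrim (hr : 1 ≤ r) (m : ℤ) :
    ContinuousOn (fcPrim r m) (Set.Icc 0 (π / ((r : ℝ) + 1))) := by
  unfold fcPrim
  split_ifs
  · exact (continuous_const.mul continuous_id).continuousOn
  · refine ContinuousOn.div_const (Complex.continuous_im.comp_continuousOn
      (ContinuousOn.zpow₀ ?_ m fun φ hφ => Or.inl (fcCurve_ne_zero hr hφ))) _
    refine (Complex.continuous_ofReal.comp_continuousOn (continuousOn_sinRatio hr)).mul ?_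
    exact Continuous.continuousOn (by fun_prop)

lemma fcPrim_zero (m : ℤ) : fcPrim r m 0 = 0 := by
  unfold fcPrim
  split_ifs
  · simp
  · simp [fcCurve, ← Complex.ofReal_zpow]

lemma fcPrim_end (m : ℤ) : fcPrim r m (π / ((r : ℝ) + 1)) = if m = 0 then π else 0 := by
  have hr1 : (r : ℝ) + 1 ≠ 0 := by positivity
  unfold fcPrim
  split_ifs
  · field_simp
  · rw [fcCurve, mul_div_cancel₀ _ hr1, Complex.exp_pi_mul_I, ← Complex.ofReal_one,
      ← Complex.ofReal_neg, ← Complex.ofReal_mul, ← Complex.ofReal_zpow, Complex.ofReal_im,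
      zero_div]

lemma fcPrim_one : fcPrim r 1 φ = sinRatio r φ * sin ((r + 1) * φ) := by
  rw [fcPrim, if_neg one_ne_zero, zpow_one, fcCurve, Complex.im_ofReal_mul,
    Complex.exp_ofReal_mul_I_im, Int.cast_one, div_one]

lemma one_add_fcCurve_pow (hr : 1 ≤ r) (hφ : φ ∈ Set.Ioo 0 (π / ((r : ℝ) + 1))) :
    (1 + fcCurve r φ) ^ (r + 1) = fcRho r φ * fcCurve r φ := by
  have hq := sinRatio_pos hr (Set.Ioo_subset_Icc_self hφ)
  have h1 := cos_add_mul_sinRatio hr hφ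
  have h2 := (sin_pos_of_mem_Ioo hr hφ).2.1.ne'
  have hq2 := sinRatio_eq hr hφ.1.ne'
  have hone : 1 + fcCurve r φ =
      (cos φ + cos (r * φ) * sinRatio r φ : ℝ) * Complex.exp (φ * Complex.I) := by
    have hadd : ((r : ℝ) + 1) * φ = r * φ + φ := by ring
    have hs : sin (r * φ) * sinRatio r φ = sin φ := by
      rw [hq2]; field_simp
    have hsq := sin_sq_add_cos_sq φ
    apply Complex.ext
    · rw [fcCurve, Complex.add_re, Complex.one_re, Complex.re_ofReal_mul, Complex.re_ofReal_mul,
        Complex.exp_ofReal_mul_I_re, Complex.exp_ofReal_mul_I_re, hadd, cos_add]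
      linear_combination -hsq - sin φ * hs
    · rw [fcCurve, Complex.add_im, Complex.one_im, Complex.im_ofReal_mul, Complex.im_ofReal_mul,
        Complex.exp_ofReal_mul_I_im, Complex.exp_ofReal_mul_I_im, hadd, sin_add]
      linear_combination cos φ * hs
  have hexp : Complex.exp (φ * Complex.I) ^ (r + 1) =
      Complex.exp (((r + 1) * φ : ℝ) * Complex.I) := by
    rw [← Complex.exp_nat_mul]
    congr 1
    push_cast
    ring
  rw [hone, mul_pow, hexp, fcCurve, fcRho, ← mul_assoc, ← Complex.ofReal_mul,
    div_mul_cancel₀ _ hq.ne', Complex.ofReal_pow]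

lemma exists_hasDerivAt_fcPrim (hr : 1 ≤ r) (hφ : φ ∈ Set.Ioo 0 (π / ((r : ℝ) + 1))) :
    ∃ d : ℂ, ∀ m : ℤ, HasDerivAt (fcPrim r m) (fcCurve r φ ^ (m - 1) * d).im φ := by
  have hφ' := Set.Ioo_subset_Icc_self hφ
  obtain ⟨h1, h2, -⟩ := sin_pos_of_mem_Ioo hr hφ
  obtain ⟨q', hq'⟩ : ∃ q', HasDerivAt (sinRatio r) q' φ := by
    have hd : HasDerivAt (fun x => sin (r * x)) (cos (r * φ) * r) φ := by
      simpa using ((hasDerivAt_id φ).const_mul (r : ℝ)).sin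
    refine ⟨_, ((hasDerivAt_sin φ).div hd h2.ne').congr_of_eventuallyEq ?_⟩
    filter_upwards [eventually_mem_Ioo hφ] with x hx
    exact sinRatio_eq hr hx.1.ne'
  have hq := Complex.ofReal_ne_zero.2 (sinRatio_pos hr hφ').ne'
  have hs := fcCurve_ne_zero hr hφ'
  have hlin : HasDerivAt (fun x : ℝ => (((r + 1) * x : ℝ) : ℂ) * Complex.I)
      (((r + 1 : ℝ) : ℂ) * Complex.I) φ := by
    have : HasDerivAt (fun x : ℝ => (r + 1) * x) ((r : ℝ) + 1) φ := by
      simpa using (hasDerivAt_id φ).const_mul ((r : ℝ) + 1)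
    exact this.ofReal_comp.mul_const _
  have hcurve : HasDerivAt (fcCurve r)
      (fcCurve r φ * (q' / sinRatio r φ + ((r + 1 : ℝ) : ℂ) * Complex.I)) φ := by
    refine (hq'.ofReal_comp.mul hlin.cexp).congr_deriv ?_
    simp only [fcCurve]
    field_simp
  refine ⟨fcCurve r φ * (q' / sinRatio r φ + ((r + 1 : ℝ) : ℂ) * Complex.I), fun m => ?_⟩
  · rcases eq_or_ne m 0 with rfl | hm
    · have hfun : fcPrim r 0 = fun x => ((r : ℝ) + 1) * x := by
        funext x
        simp [fcPrim]
      have hval : (fcCurve r φ ^ ((0 : ℤ) - 1) * (fcCurve r φ * (q' / sinRatio r φ +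
          ((r + 1 : ℝ) : ℂ) * Complex.I))).im = r + 1 := by
        rw [zero_sub, zpow_neg_one, inv_mul_cancel_left₀ hs, ← Complex.ofReal_div]
        simp
      rw [hfun, hval]
      simpa using (hasDerivAt_id φ).const_mul ((r : ℝ) + 1)
    · have hm' : (m : ℝ) ≠ 0 := Int.cast_ne_zero.2 hm
      have hfun : fcPrim r m = fun x => (fcCurve r x ^ m).im / m := by
        funext x
        simp [fcPrim, hm]
      rw [hfun]
      have h3 := ((hasDerivAt_zpow m (fcCurve r φ) (Or.inl hs)).comp φ hcurve)
      have h4 := (Complex.imCLM.hasFDerivAt.comp_hasDerivAt φ h3).div_const (m : ℝ)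
      refine h4.congr_deriv ?_
      rw [Complex.imCLM_apply, mul_assoc, ← Complex.ofReal_intCast, Complex.im_ofReal_mul,
        mul_div_cancel_left₀ _ hm']

lemma fcAngle_le_pi (hr : 1 ≤ r) (hφ : φ ∈ Set.Ioo 0 (π / ((r : ℝ) + 1))) :
    fcAngle r φ ≤ π := by
  have h1 : φ * ((r : ℝ) + 1) < π := (lt_div_iff₀ (by positivity)).1 hφ.2
  have h2 := mul_pos (sinRatio_pos hr (Set.Ioo_subset_Icc_self hφ)) (sin_pos_of_mem_Ioo hr hφ).2.2
  rw [← fcPrim_one] at h2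
  have h3 : fcPrim r 0 φ = (r + 1) * φ := by simp [fcPrim]
  rw [fcAngle, h3]
  have : 0 ≤ (r : ℝ) * fcPrim r 1 φ := by positivity
  linarith

lemma fcAngle_eq (hr : 1 ≤ r) (hφ : φ ∈ Set.Ioo 0 (π / ((r : ℝ) + 1))) :
    fcAngle r φ = (r + 1) * φ - r * (sin ((r + 1) * φ) / sin (r * φ)) * sin φ := by
  have h3 : fcPrim r 0 φ = (r + 1) * φ := by simp [fcPrim]
  rw [fcAngle, h3, fcPrim_one, sinRatio_eq hr hφ.1.ne']
  ring

/-- An antiderivative of `-(ρ ^ k)' f`. -/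
noncomputable def fcMomentPrim (r k : ℕ) (φ : ℝ) : ℝ :=
  (∑ j ∈ Finset.range ((r + 1) * k + 1), (((r + 1) * k).choose j : ℝ) *
    (fcPrim r ((j : ℤ) - k) φ - r * fcPrim r ((j : ℤ) - k + 1) φ)) - fcRho r φ ^ k * fcAngle r φ

lemma continuousOn_fcMomentPrim (hr : 1 ≤ r) (k : ℕ) :
    ContinuousOn (fcMomentPrim r k) (Set.Icc 0 (π / ((r : ℝ) + 1))) := by
  have h := continuousOn_fcPrim hr
  refine ContinuousOn.sub (continuousOn_finsetSum _ fun j _ => ?_)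
    (((continuousOn_fcRho hr).pow k).mul ?_)
  · exact continuousOn_const.mul ((h _).sub (continuousOn_const.mul (h _)))
  · exact (h 0).sub (continuousOn_const.mul (h 1))

lemma hasDerivAt_fcMomentPrim (hr : 1 ≤ r) (hφ : φ ∈ Set.Ioo 0 (π / ((r : ℝ) + 1))) {d : ℝ}
    (hd : HasDerivAt (fcRho r) d φ) (k : ℕ) :
    HasDerivAt (fcMomentPrim r k) (-(k * fcRho r φ ^ (k - 1) * d * fcAngle r φ)) φ := by
  obtain ⟨s', hs'⟩ := exists_hasDerivAt_fcPrim hr hφ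
  have hs := fcCurve_ne_zero hr (Set.Ioo_subset_Icc_self hφ)
  have hangle : HasDerivAt (fcAngle r)
      ((fcCurve r φ ^ (-1 : ℤ) * s').im - r * (fcCurve r φ ^ (0 : ℤ) * s').im) φ :=
    (hs' 0).sub ((hs' 1).const_mul (r : ℝ))
  have hsum := HasDerivAt.fun_sum (u := Finset.range ((r + 1) * k + 1)) fun j _ =>
    ((hs' ((j : ℤ) - k)).sub ((hs' ((j : ℤ) - k + 1)).const_mul (r : ℝ))).const_mul
      (((r + 1) * k).choose j : ℝ)
  refine (hsum.sub ((hd.pow k).mul hangle)).congr_deriv ?_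
  have hbinom : ∑ j ∈ Finset.range ((r + 1) * k + 1), (((r + 1) * k).choose j : ℂ) *
      (fcCurve r φ ^ ((j : ℤ) - k - 1) * s' - r * (fcCurve r φ ^ ((j : ℤ) - k + 1 - 1) * s')) =
      (fcRho r φ ^ k : ℝ) * (fcCurve r φ ^ (-1 : ℤ) * s' - r * (fcCurve r φ ^ (0 : ℤ) * s')) := by
    have h1 : (1 + fcCurve r φ) ^ ((r + 1) * k) * fcCurve r φ ^ (-k : ℤ) =
        (fcRho r φ ^ k : ℝ) := by
      rw [pow_mul, one_add_fcCurve_pow hr hφ, mul_pow, mul_assoc, zpow_neg, zpow_natCast,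
        mul_inv_cancel₀ (pow_ne_zero _ hs), mul_one, Complex.ofReal_pow]
    rw [← h1, add_comm (1 : ℂ), add_pow, Finset.sum_mul, Finset.sum_mul]
    refine Finset.sum_congr rfl fun j _ => ?_
    have e1 : fcCurve r φ ^ ((j : ℤ) - k - 1) =
        fcCurve r φ ^ j * fcCurve r φ ^ (-k : ℤ) * fcCurve r φ ^ (-1 : ℤ) := by
      rw [← zpow_natCast, ← zpow_add₀ hs, ← zpow_add₀ hs]; rfl
    have e2 : fcCurve r φ ^ ((j : ℤ) - k + 1 - 1) =
        fcCurve r φ ^ j * fcCurve r φ ^ (-k : ℤ) * fcCurve r φ ^ (0 : ℤ) := by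
      rw [← zpow_natCast, ← zpow_add₀ hs, ← zpow_add₀ hs]; congr 1; ring
    rw [e1, e2]
    ring
  have him := congrArg Complex.im hbinom
  rw [Complex.im_ofReal_mul, Complex.im_sum] at him
  simp only [← Complex.ofReal_natCast, Complex.im_ofReal_mul, Complex.sub_im] at him
  rw [him, Pi.pow_apply]
  ring

lemma fcMomentPrim_zero (k : ℕ) : fcMomentPrim r k 0 = 0 := by
  simp [fcMomentPrim, fcAngle, fcPrim_zero]

lemma fcMomentPrim_end (hr : 1 ≤ r) (k : ℕ) :
    fcMomentPrim r (k + 1) (π / ((r : ℝ) + 1)) = π * raney r (k + 1) 1 := by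
  have e (m : ℤ) (c : ℝ) : c * (if m = 0 then π else 0) = if m = 0 then c * π else 0 := by
    split_ifs <;> simp
  have h1 (j : ℕ) : (j : ℤ) - (k + 1 : ℕ) = 0 ↔ j = k + 1 := by omega
  have h2 (j : ℕ) : (j : ℤ) - (k + 1 : ℕ) + 1 = 0 ↔ j = k := by omega
  have h3 : k + 1 < (r + 1) * (k + 1) + 1 := by nlinarith
  simp only [fcMomentPrim, fcRho_end hr, fcPrim_end, h1, h2, mul_sub, Finset.sum_sub_distrib,
    mul_ite, mul_zero, Finset.sum_ite_eq', Finset.mem_range, h3, (Nat.lt_succ_self k).trans h3]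
  simp only [if_true, raney]
  rw [show 1 + (r + 1) * k + r = (r + 1) * (k + 1) by ring]
  simp
  ring

end FussCatalan

section Moments

variable {r : ℕ} {ρinv V : ℝ → ℝ} {μ : Measure ℝ}

lemma image_fcRho (hr : 1 ≤ r)
    (hρinv : ∀ x ∈ Set.Ioo (0 : ℝ) (((r : ℝ) + 1) ^ (r + 1) / (r : ℝ) ^ r),
      ρinv x ∈ Set.Ioo 0 (π / ((r : ℝ) + 1)) ∧ fcRho r (ρinv x) = x) :
    fcRho r '' Set.Ioo 0 (π / ((r : ℝ) + 1)) =
      Set.Ioo (0 : ℝ) (((r : ℝ) + 1) ^ (r + 1) / (r : ℝ) ^ r) := by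
  ext x
  constructor
  · rintro ⟨φ, hφ, rfl⟩
    refine ⟨fcRho_pos hr hφ, ?_⟩
    rw [← fcRho_zero hr]
    exact strictAntiOn_fcRho hr ⟨le_rfl, by positivity⟩ (Set.Ioo_subset_Icc_self hφ) hφ.1
  · intro hx
    exact ⟨ρinv x, hρinv x hx⟩

lemma measure_univ_of_cdf {M : ℝ} (hV2 : ∀ x, M ≤ x → V x = 1)
    (hμ : ∀ x, μ (Set.Iic x) = ENNReal.ofReal (V x)) : μ Set.univ = 1 := by
  refine tendsto_nhds_unique (tendsto_measure_Iic_atTop μ) (tendsto_const_nhds.congr' ?_)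
  filter_upwards [eventually_ge_atTop M] with x hx
  rw [hμ, hV2 x hx, ENNReal.ofReal_one]

/-- The moments of the distribution with distribution function `V` are the Fuss–Catalan numbers. -/
lemma lintegral_pow_of_cdf (hr : 1 ≤ r)
    (hρinv : ∀ x ∈ Set.Ioo (0 : ℝ) (((r : ℝ) + 1) ^ (r + 1) / (r : ℝ) ^ r),
      ρinv x ∈ Set.Ioo 0 (π / ((r : ℝ) + 1)) ∧ fcRho r (ρinv x) = x)
    (hV0 : V 0 = 0)
    (hV1 : ∀ x : ℝ, 0 < x → x < ((r : ℝ) + 1) ^ (r + 1) / (r : ℝ) ^ r →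
      V x = 1 - (1 / π) * fcAngle r (ρinv x))
    (hV2 : ∀ x : ℝ, ((r : ℝ) + 1) ^ (r + 1) / (r : ℝ) ^ r ≤ x → V x = 1)
    (hμ : ∀ x : ℝ, μ (Set.Iic x) = ENNReal.ofReal (V x)) (k : ℕ) :
    0 ≤ raney r k 1 ∧ ∫⁻ x, ENNReal.ofReal (x ^ k) ∂μ = ENNReal.ofReal (raney r k 1) := by
  set M : ℝ := ((r : ℝ) + 1) ^ (r + 1) / (r : ℝ) ^ r with hM
  have hMpos : 0 < M := by
    have : (0 : ℝ) < r := by exact_mod_cast hr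
    positivity
  have huniv : μ Set.univ = 1 := measure_univ_of_cdf hV2 hμ
  have hprob : IsProbabilityMeasure μ := ⟨huniv⟩
  cases k with
  | zero => simp [raney]
  | succ k =>
  have hpos : 0 ≤ᵐ[μ] (id : ℝ → ℝ) := by
    have h0 : μ (Set.Iic 0) = 0 := by rw [hμ, hV0, ENNReal.ofReal_zero]
    filter_upwards [measure_eq_zero_iff_ae_notMem.1 h0] with x hx
    exact (not_le.1 hx).le
  have hinj : Set.InjOn (fcRho r) (Set.Ioo 0 (π / ((r : ℝ) + 1))) :=
    (strictAntiOn_fcRho hr).injOn.mono Set.Ioo_subset_Icc_self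
  have himage := image_fcRho hr hρinv
  have hinv : ∀ φ ∈ Set.Ioo 0 (π / ((r : ℝ) + 1)), ρinv (fcRho r φ) = φ := by
    intro φ hφ
    have hx := hρinv _ (himage ▸ Set.mem_image_of_mem _ hφ)
    exact hinj hx.1 hφ hx.2
  have htail : ∀ φ ∈ Set.Ioo 0 (π / ((r : ℝ) + 1)),
      0 ≤ fcAngle r φ ∧ μ (Set.Ioi (fcRho r φ)) = ENNReal.ofReal (fcAngle r φ / π) := by
    intro φ hφ
    have hx : fcRho r φ ∈ Set.Ioo 0 M := himage ▸ Set.mem_image_of_mem _ hφ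
    have hVx := hV1 _ hx.1 hx.2
    rw [hinv φ hφ] at hVx
    have hle : V (fcRho r φ) ≤ 1 := by
      rw [← ENNReal.ofReal_le_one, ← hμ]
      exact prob_le_one
    have h0 : 0 ≤ fcAngle r φ := by
      have : 0 ≤ 1 / π * fcAngle r φ := by linarith
      exact nonneg_of_mul_nonneg_right this (by positivity)
    refine ⟨h0, ?_⟩
    have hVnn : 0 ≤ V (fcRho r φ) := by
      rw [hVx, sub_nonneg, one_div_mul_eq_div, div_le_one pi_pos]
      exact fcAngle_le_pi hr hφ
    rw [← Set.compl_Iic, prob_compl_eq_one_sub measurableSet_Iic, hμ, ← ENNReal.ofReal_one,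
      ← ENNReal.ofReal_sub _ hVnn, hVx]
    congr 1
    ring
  have htail0 : ∀ t, M ≤ t → μ (Set.Ioi t) = 0 := by
    intro t ht
    rw [← Set.compl_Iic, prob_compl_eq_one_sub measurableSet_Iic, hμ, hV2 t ht]
    simp
  have hcake := lintegral_comp_eq_lintegral_meas_lt_mul μ (f := id)
    (g := fun t : ℝ => ((k : ℝ) + 1) * t ^ k) hpos aemeasurable_id
    (fun t _ =>
      (by fun_prop : Continuous fun t : ℝ => ((k : ℝ) + 1) * t ^ k).intervalIntegrable _ _)
    ((ae_restrict_iff' measurableSet_Ioi).2 (Eventually.of_forall fun t ht => by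
      have : (0 : ℝ) < t := ht
      positivity))
  have hInt : ∀ x : ℝ, ∫ t in (0 : ℝ)..x, ((k : ℝ) + 1) * t ^ k = x ^ (k + 1) := by
    intro x
    rw [intervalIntegral.integral_const_mul, integral_pow]
    have : (k : ℝ) + 1 ≠ 0 := by positivity
    field_simp
    simp
  simp only [id, hInt] at hcake
  rw [hcake]
  have hunion : Set.Ioi (0 : ℝ) = Set.Ioo 0 M ∪ Set.Ici M := (Set.Ioo_union_Ici_eq_Ioi hMpos).symm
  have hdisj : Disjoint (Set.Ioo 0 M) (Set.Ici M) :=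
    Set.disjoint_left.2 fun x hx hx' => not_le.2 hx.2 hx'
  have hzero : ∫⁻ t in Set.Ici M, μ {a | t < a} * ENNReal.ofReal (((k : ℝ) + 1) * t ^ k) = 0 := by
    refine (setLIntegral_congr_fun measurableSet_Ici fun t ht => ?_).trans lintegral_zero
    have : μ {a | t < a} = 0 := htail0 t ht
    simp [this]
  rw [hunion, lintegral_union measurableSet_Ici hdisj, hzero, add_zero, ← himage]
  have hderiv : ∀ φ ∈ Set.Ioo 0 (π / ((r : ℝ) + 1)),
      HasDerivAt (fcRho r) (deriv (fcRho r) φ) φ ∧ deriv (fcRho r) φ < 0 := by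
    intro φ hφ
    obtain ⟨d, hd, h⟩ := exists_hasDerivAt_fcRho hr hφ
    rw [h.deriv]
    exact ⟨h, hd⟩
  rw [lintegral_image_eq_lintegral_abs_deriv_mul measurableSet_Ioo
    (fun φ hφ => (hderiv φ hφ).1.hasDerivWithinAt) hinj]
  set E' : ℝ → ℝ := fun φ =>
    -(((k + 1 : ℕ) : ℝ) * fcRho r φ ^ k * deriv (fcRho r) φ * fcAngle r φ) with hE'
  have hEderiv : ∀ φ ∈ Set.Ioo 0 (π / ((r : ℝ) + 1)),
      HasDerivAt (fcMomentPrim r (k + 1)) (E' φ) φ := by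
    intro φ hφ
    exact hasDerivAt_fcMomentPrim hr hφ (hderiv φ hφ).1 (k + 1)
  have hEnn : ∀ φ ∈ Set.Ioo 0 (π / ((r : ℝ) + 1)), 0 ≤ E' φ := by
    intro φ hφ
    have h1 := (fcRho_pos hr hφ).le
    have h2 := (hderiv φ hφ).2.le
    have h3 := (htail φ hφ).1
    rw [hE', neg_nonneg]
    exact mul_nonpos_of_nonpos_of_nonneg (mul_nonpos_of_nonneg_of_nonpos (by positivity) h2) h3
  have hcont := continuousOn_fcMomentPrim hr (k + 1)
  have hEint : IntegrableOn E' (Set.Ioc 0 (π / ((r : ℝ) + 1))) :=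
    intervalIntegral.integrableOn_deriv_of_nonneg hcont hEderiv hEnn
  have hle : 0 ≤ π / ((r : ℝ) + 1) := by positivity
  have hftc := intervalIntegral.integral_eq_sub_of_hasDerivAt_of_le hle hcont hEderiv
    ((intervalIntegrable_iff_integrableOn_Ioc_of_le hle).2 hEint)
  rw [fcMomentPrim_zero, fcMomentPrim_end hr, sub_zero, intervalIntegral.integral_of_le hle,
    integral_Ioc_eq_integral_Ioo] at hftc
  have hval : ∫ φ in Set.Ioo 0 (π / ((r : ℝ) + 1)), E' φ / π = raney r (k + 1) 1 := by
    rw [integral_div, hftc, mul_div_cancel_left₀ _ pi_ne_zero]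
  refine ⟨hval ▸ setIntegral_nonneg measurableSet_Ioo fun φ hφ =>
    div_nonneg (hEnn φ hφ) pi_pos.le, ?_⟩
  rw [← hval, ofReal_integral_eq_lintegral_ofReal
    ((hEint.mono_set Set.Ioo_subset_Ioc_self).div_const _)
    ((ae_restrict_iff' measurableSet_Ioo).2 (Eventually.of_forall fun φ hφ =>
      div_nonneg (hEnn φ hφ) pi_pos.le))]
  refine setLIntegral_congr_fun measurableSet_Ioo fun φ hφ => ?_
  have h1 := (fcRho_pos hr hφ).le
  have h4 : μ {a | fcRho r φ < a} = ENNReal.ofReal (fcAngle r φ / π) := (htail φ hφ).2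
  rw [h4, ← ENNReal.ofReal_mul (div_nonneg (htail φ hφ).1 pi_pos.le),
    ← ENNReal.ofReal_mul (abs_nonneg _), abs_of_neg (hderiv φ hφ).2, hE']
  congr 1
  push_cast
  ring

end Moments

lemma integral_pow_le_of_ae_mem_Icc {μ : Measure ℝ} [IsProbabilityMeasure μ] {M : ℝ}
    (hμ : ∀ᵐ x ∂μ, x ∈ Set.Icc 0 M) (k : ℕ) : ∫ x, x ^ k ∂μ ≤ M ^ k := by
  have h : ∫ x, x ^ k ∂μ ≤ ∫ _, M ^ k ∂μ := by
    refine integral_mono_of_nonneg ?_ (integrable_const _) ?_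
    · filter_upwards [hμ] with x hx using pow_nonneg hx.1 k
    · filter_upwards [hμ] with x hx using pow_le_pow_left₀ hx.1 hx.2 k
  simpa using h

lemma integrable_pow_of_ae_mem_Icc {μ : Measure ℝ} [IsProbabilityMeasure μ] {M : ℝ}
    (hμ : ∀ᵐ x ∂μ, x ∈ Set.Icc 0 M) (k : ℕ) : Integrable (fun x => x ^ k) μ := by
  refine Integrable.of_bound (by fun_prop) (M ^ k) ?_
  filter_upwards [hμ] with x hx
  rw [Real.norm_eq_abs, abs_of_nonneg (pow_nonneg hx.1 k)]
  exact pow_le_pow_left₀ hx.1 hx.2 k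

/-- Weierstrass approximation of a bounded continuous function by a polynomial, with an error
controlled by arbitrarily high powers outside `[-K, K]`. -/
lemma exists_polynomial_abs_sub_le (g : BoundedContinuousFunction ℝ ℝ) {K : ℝ} (hK : 1 ≤ K)
    {ε : ℝ} (hε : 0 < ε) :
    ∃ (p : ℝ[X]) (C : ℝ), 0 ≤ C ∧ ∀ N, p.natDegree ≤ N → ∀ x : ℝ,
      |g x - p.eval x| ≤ ε + C * (x / K) ^ (2 * N) := by
  obtain ⟨p, hp⟩ := exists_polynomial_near_of_continuousOn (-K) K g g.continuous.continuousOn ε hε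
  have hK0 : 0 < K := by linarith
  set C : ℝ := ‖g‖ + ∑ i ∈ Finset.range (p.natDegree + 1), |p.coeff i| * K ^ i with hC
  have hC0 : 0 ≤ C := by positivity
  refine ⟨p, C, hC0, fun N hN x => ?_⟩
  have hpow : 0 ≤ (x / K) ^ (2 * N) := (even_two_mul N).pow_nonneg _
  by_cases hx : x ∈ Set.Icc (-K) K
  · have h := (hp x hx).le
    rw [abs_sub_comm] at h
    nlinarith [mul_nonneg hC0 hpow]
  · have hy : 1 ≤ |x| / K := by
      rw [one_le_div hK0]
      by_contra! h
      exact hx (abs_le.1 h.le)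
    have hpw : (x / K) ^ (2 * N) = (|x| / K) ^ (2 * N) := by
      rw [← (even_two_mul N).pow_abs, abs_div, abs_of_pos hK0]
    have h1 : |g x| ≤ ‖g‖ * (x / K) ^ (2 * N) := by
      rw [hpw]
      exact (g.norm_coe_le_norm x).trans (le_mul_of_one_le_right (norm_nonneg _) (one_le_pow₀ hy))
    have h2 : |p.eval x| ≤
        (∑ i ∈ Finset.range (p.natDegree + 1), |p.coeff i| * K ^ i) * (x / K) ^ (2 * N) := by
      rw [eval_eq_sum_range, Finset.sum_mul, hpw]
      refine (Finset.abs_sum_le_sum_abs _ _).trans (Finset.sum_le_sum fun i hi => ?_)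
      rw [Finset.mem_range] at hi
      have h3 : |x| ^ i = K ^ i * (|x| / K) ^ i := by
        rw [← mul_pow, mul_div_cancel₀ _ hK0.ne']
      rw [abs_mul, abs_pow, h3, ← mul_assoc]
      exact mul_le_mul_of_nonneg_left (pow_le_pow_right₀ hy (by omega)) (by positivity)
    calc |g x - p.eval x| ≤ |g x| + |p.eval x| := abs_sub _ _
      _ ≤ C * (x / K) ^ (2 * N) := by rw [hC, add_mul]; exact add_le_add h1 h2
      _ ≤ _ := by linarith

lemma integral_eval_eq_sum {μ : Measure ℝ} (hInt : ∀ k : ℕ, Integrable (fun x => x ^ k) μ)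
    (p : ℝ[X]) :
    Integrable (fun x => p.eval x) μ ∧
      ∫ x, p.eval x ∂μ = ∑ i ∈ Finset.range (p.natDegree + 1), p.coeff i * ∫ x, x ^ i ∂μ := by
  have h : ∀ i ∈ Finset.range (p.natDegree + 1), Integrable (fun x => p.coeff i * x ^ i) μ :=
    fun i _ => (hInt i).const_mul _
  simp only [eval_eq_sum_range]
  refine ⟨integrable_finsetSum _ h, ?_⟩
  rw [integral_finsetSum _ h]
  simp only [integral_const_mul]

lemma abs_integral_sub_le {μ : Measure ℝ} [IsProbabilityMeasure μ]
    (hInt : ∀ k : ℕ, Integrable (fun x => x ^ k) μ) (g : BoundedContinuousFunction ℝ ℝ) {p : ℝ[X]}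
    {a b K : ℝ} {k : ℕ} (h : ∀ x : ℝ, |g x - p.eval x| ≤ a + b * (x / K) ^ k) :
    |∫ x, g x ∂μ - ∫ x, p.eval x ∂μ| ≤ a + b / K ^ k * ∫ x, x ^ k ∂μ := by
  rw [← integral_sub (g.integrable μ) (integral_eval_eq_sum hInt p).1]
  have hi : Integrable (fun x => b / K ^ k * x ^ k) μ := (hInt k).const_mul _
  have hb : ∀ x, ‖g x - p.eval x‖ ≤ a + b / K ^ k * x ^ k := fun x =>
    (h x).trans_eq (by rw [div_pow]; ring)
  refine (norm_integral_le_of_norm_le ((integrable_const a).add hi)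
    (Eventually.of_forall hb)).trans_eq ?_
  rw [integral_add' (integrable_const a) hi, integral_const_mul]
  simp

/-- The method of moments for a compactly supported limit law. -/
lemma tendsto_integral_of_tendsto_moments {μ : Measure ℝ} [IsProbabilityMeasure μ] {M : ℝ}
    (hM : 0 ≤ M) (hμ : ∀ᵐ x ∂μ, x ∈ Set.Icc 0 M) {μn : ℕ → Measure ℝ}
    (hprob : ∀ᶠ n in atTop, IsProbabilityMeasure (μn n))
    (hInt : ∀ᶠ n in atTop, ∀ k : ℕ, Integrable (fun x => x ^ k) (μn n))
    (hmom : ∀ k : ℕ, Tendsto (fun n => ∫ x, x ^ k ∂(μn n)) atTop (nhds (∫ x, x ^ k ∂μ)))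
    (g : BoundedContinuousFunction ℝ ℝ) :
    Tendsto (fun n => ∫ x, g x ∂(μn n)) atTop (nhds (∫ x, g x ∂μ)) := by
  rw [Metric.tendsto_nhds]
  intro ε hε
  have hK : 1 ≤ M + 1 := by linarith
  obtain ⟨p, C, hC, hp⟩ := exists_polynomial_abs_sub_le g hK (ε := ε / 5) (by positivity)
  have hgeom : Tendsto (fun N : ℕ => C * ((M / (M + 1)) ^ 2) ^ N) atTop (nhds 0) := by
    have hlt : M / (M + 1) < 1 := (div_lt_one (by linarith)).2 (by linarith)
    have h0 : 0 ≤ M / (M + 1) := by positivity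
    simpa using (tendsto_pow_atTop_nhds_zero_of_lt_one (sq_nonneg _)
      (pow_lt_one₀ h0 hlt two_ne_zero)).const_mul C
  obtain ⟨N, hN, hNC⟩ := ((eventually_ge_atTop p.natDegree).and
    (hgeom.eventually_lt_const (by positivity : 0 < ε / 5))).exists
  have hb := hp N hN
  have hμb := abs_integral_sub_le (integrable_pow_of_ae_mem_Icc hμ) g hb
  have hlim : ε / 5 + C / (M + 1) ^ (2 * N) * ∫ x, x ^ (2 * N) ∂μ < 2 * (ε / 5) := by
    have h1 : C / (M + 1) ^ (2 * N) * ∫ x, x ^ (2 * N) ∂μ ≤ C * ((M / (M + 1)) ^ 2) ^ N := by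
      calc _ ≤ C / (M + 1) ^ (2 * N) * M ^ (2 * N) :=
            mul_le_mul_of_nonneg_left (integral_pow_le_of_ae_mem_Icc hμ _) (by positivity)
        _ = _ := by rw [← pow_mul, div_pow]; ring
    linarith
  have hpoly : Tendsto (fun n => ∑ i ∈ Finset.range (p.natDegree + 1),
      p.coeff i * ∫ x, x ^ i ∂(μn n)) atTop (nhds (∫ x, p.eval x ∂μ)) := by
    rw [(integral_eval_eq_sum (integrable_pow_of_ae_mem_Icc hμ) p).2]
    exact tendsto_finsetSum _ fun i _ => (hmom i).const_mul _
  filter_upwards [hprob, hInt, Metric.tendsto_nhds.1 hpoly (ε / 5) (by positivity),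
    (((hmom (2 * N)).const_mul (C / (M + 1) ^ (2 * N))).const_add (ε / 5)).eventually_lt_const hlim]
    with n hn1 hn2 hn3 hn4
  have hnb := abs_integral_sub_le hn2 g hb
  rw [← (integral_eval_eq_sum hn2 p).2, Real.dist_eq] at hn3
  rw [Real.dist_eq]
  have h1 := abs_le.1 hμb
  have h2 := abs_le.1 hnb
  have h3 := abs_lt.1 hn3
  exact abs_lt.2 ⟨by linarith, by linarith⟩

lemma integral_sum_dirac (S : Multiset ℝ) (h : ℝ → ℝ) :
    Integrable h (S.map Measure.dirac).sum ∧
      ∫ x, h x ∂(S.map Measure.dirac).sum = (S.map h).sum := by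
  induction S using Multiset.induction_on with
  | empty => simp
  | cons a S ih =>
    have ha : Integrable h (Measure.dirac a) := integrable_dirac enorm_lt_top
    rw [Multiset.map_cons, Multiset.sum_cons, Multiset.map_cons, Multiset.sum_cons,
      integral_add_measure ha ih.1, integral_dirac, ih.2]
    exact ⟨ha.add_measure ih.1, rfl⟩

lemma sum_dirac_univ (S : Multiset ℝ) : (S.map Measure.dirac).sum Set.univ = S.card := by
  induction S using Multiset.induction_on with
  | empty => simp
  | cons a S ih => simp [ih, add_comm]

/-- Coefficients of the rescaled polynomials. -/
noncomputable def hypCoeff (l : List ℕ) (n k : ℕ) : ℝ :=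
  (-1) ^ k * (n.choose k : ℝ) / (l.map fun a => ((k + a).factorial : ℝ)).prod *
    ((n : ℝ) ^ l.length) ^ k

lemma prod_factorial_pos (l : List ℕ) (k : ℕ) :
    0 < (l.map fun a => ((k + a).factorial : ℝ)).prod := by
  induction l with
  | nil => simp
  | cons a l ih =>
    rw [List.map_cons, List.prod_cons]
    positivity

lemma prod_factorial_succ (l : List ℕ) (k : ℕ) :
    (l.map fun a => ((k + 1 + a).factorial : ℝ)).prod =
      (l.map fun a : ℕ => (k : ℝ) + 1 + a).prod *
        (l.map fun a => ((k + a).factorial : ℝ)).prod := by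
  rw [← List.prod_map_mul]
  congr 1
  refine List.map_congr_left fun a _ => ?_
  rw [add_right_comm, Nat.factorial_succ]
  push_cast
  ring

lemma hypCoeff_self_ne_zero (l : List ℕ) (n : ℕ) : hypCoeff l n n ≠ 0 := by
  have h := (prod_factorial_pos l n).ne'
  have h' : ((n : ℝ) ^ l.length) ^ n ≠ 0 := by
    rcases eq_or_ne n 0 with rfl | hn
    · simp
    · positivity
  simp [hypCoeff, h, h']

lemma hypCoeff_succ (l : List ℕ) {n k : ℕ} (hk : k < n) :
    (l.map fun a : ℕ => (k : ℝ) + 1 + a).prod * (k + 1) * hypCoeff l n (k + 1) =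
      (n : ℝ) ^ l.length * (k - n) * hypCoeff l n k := by
  have h1 := (prod_factorial_pos l k).ne'
  have h2 := (prod_factorial_pos l (k + 1)).ne'
  rw [prod_factorial_succ] at h2
  have h3 : (n.choose (k + 1) : ℝ) * (k + 1) = n.choose k * (n - k) := by
    rw [← Nat.cast_sub hk.le]
    exact_mod_cast Nat.choose_succ_right_eq n k
  have h4 := left_ne_zero_of_mul h2
  rw [hypCoeff, hypCoeff, prod_factorial_succ]
  field_simp
  linear_combination (-1) ^ (k + 1) * ((n : ℝ) ^ l.length) ^ (k + 1) * h3

lemma sum_hypCoeff_eq_comp (l : List ℕ) (n : ℕ) :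
    ∑ k ∈ Finset.range (n + 1), C (hypCoeff l n k) * X ^ k =
      (∑ k ∈ Finset.range (n + 1),
        C ((-1) ^ k * (n.choose k : ℝ) / (l.map fun a => ((k + a).factorial : ℝ)).prod) *
          X ^ k).comp (C ((n : ℝ) ^ l.length) * X) := by
  rw [Polynomial.sum_comp]
  refine Finset.sum_congr rfl fun k _ => ?_
  rw [mul_comp, C_comp, X_pow_comp, mul_pow, ← C_pow, ← mul_assoc, ← C_mul, hypCoeff]

lemma splits_sum_hypCoeff (l : List ℕ) (n : ℕ) :
    (∑ k ∈ Finset.range (n + 1), C (hypCoeff l n k) * X ^ k).Splits := by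
  rw [sum_hypCoeff_eq_comp]
  exact (splits_hypergeometric n l).comp_of_natDegree_le_one
    ((natDegree_C_mul_le _ _).trans natDegree_X_le)

lemma card_roots_sum_hypCoeff (l : List ℕ) (n : ℕ) :
    (∑ k ∈ Finset.range (n + 1), C (hypCoeff l n k) * X ^ k).roots.card = n := by
  rw [← (splits_sum_hypCoeff l n).natDegree_eq_card_roots,
    natDegree_sum_range_C_mul_X_pow (hypCoeff_self_ne_zero l n)]

/-- The normalized zero counting measures of the rescaled polynomials
`x ↦ F_n(n^r x)` converge weakly to the probability measure with
distribution function `V`. -/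
theorem stmt_9 (r : ℕ) (hr : 1 ≤ r) (ν : Fin r → ℕ)
    (F : ℕ → Polynomial ℝ)
    (hF : ∀ n, F n = ∑ k ∈ Finset.range (n + 1),
      Polynomial.C ((-1 : ℝ) ^ k * (n.choose k : ℝ) / ∏ j, ((k + ν j).factorial : ℝ)) *
        Polynomial.X ^ k)
    (ρ f : ℝ → ℝ)
    (hρ : ∀ φ, ρ φ = Real.sin (((r : ℝ) + 1) * φ) ^ (r + 1) /
      (Real.sin φ * Real.sin ((r : ℝ) * φ) ^ r))
    (hf : ∀ φ, f φ = ((r : ℝ) + 1) * φ -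
      (r : ℝ) * (Real.sin (((r : ℝ) + 1) * φ) / Real.sin ((r : ℝ) * φ)) * Real.sin φ)
    (ρinv : ℝ → ℝ)
    (hρinv : ∀ x ∈ Set.Ioo (0 : ℝ) (((r : ℝ) + 1) ^ (r + 1) / (r : ℝ) ^ r),
      ρinv x ∈ Set.Ioo 0 (π / ((r : ℝ) + 1)) ∧ ρ (ρinv x) = x)
    (V : ℝ → ℝ)
    (hV0 : ∀ x : ℝ, x ≤ 0 → V x = 0)
    (hV1 : ∀ x : ℝ, 0 < x → x < ((r : ℝ) + 1) ^ (r + 1) / (r : ℝ) ^ r →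
      V x = 1 - (1 / π) * f (ρinv x))
    (hV2 : ∀ x : ℝ, ((r : ℝ) + 1) ^ (r + 1) / (r : ℝ) ^ r ≤ x → V x = 1)
    (μ : Measure ℝ) (hμ : ∀ x : ℝ, μ (Set.Iic x) = ENNReal.ofReal (V x))
    (μn : ℕ → Measure ℝ)
    (hμn : ∀ n, μn n = ((n : ℝ≥0∞))⁻¹ •
      (((F n).comp (Polynomial.C ((n : ℝ) ^ r) * Polynomial.X)).roots.map
        MeasureTheory.Measure.dirac).sum) :
    ∀ g : BoundedContinuousFunction ℝ ℝ,
      Tendsto (fun n => ∫ x, g x ∂(μn n)) atTop (nhds (∫ x, g x ∂μ)) := by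
  have hr0 : (0 : ℝ) < r := by exact_mod_cast hr
  have hM : (0 : ℝ) ≤ ((r : ℝ) + 1) ^ (r + 1) / (r : ℝ) ^ r := by positivity
  have hρinv' : ∀ x ∈ Set.Ioo (0 : ℝ) (((r : ℝ) + 1) ^ (r + 1) / (r : ℝ) ^ r),
      ρinv x ∈ Set.Ioo 0 (π / ((r : ℝ) + 1)) ∧ fcRho r (ρinv x) = x := fun x hx =>
    ⟨(hρinv x hx).1, by rw [fcRho_eq hr (hρinv x hx).1, ← hρ, (hρinv x hx).2]⟩
  have hV1' : ∀ x : ℝ, 0 < x → x < ((r : ℝ) + 1) ^ (r + 1) / (r : ℝ) ^ r →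
      V x = 1 - (1 / π) * fcAngle r (ρinv x) := fun x h0 h1 => by
    rw [hV1 x h0 h1, fcAngle_eq hr (hρinv x ⟨h0, h1⟩).1, ← hf]
  have : IsProbabilityMeasure μ := ⟨measure_univ_of_cdf hV2 hμ⟩
  have hsupp : ∀ᵐ x ∂μ, x ∈ Set.Icc 0 (((r : ℝ) + 1) ^ (r + 1) / (r : ℝ) ^ r) := by
    have h1 : ∀ᵐ x ∂μ, x ∉ Set.Iic (0 : ℝ) := by
      rw [← measure_eq_zero_iff_ae_notMem, hμ, hV0 0 le_rfl, ENNReal.ofReal_zero]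
    have h2 : ∀ᵐ x ∂μ, x ∈ Set.Iic (((r : ℝ) + 1) ^ (r + 1) / (r : ℝ) ^ r) := by
      refine (mem_ae_iff_prob_eq_one measurableSet_Iic).2 ?_
      rw [hμ, hV2 _ le_rfl, ENNReal.ofReal_one]
    filter_upwards [h1, h2] with x h1 h2
    exact ⟨(not_le.1 h1).le, h2⟩
  have hmoment : ∀ k : ℕ, ∫ x, x ^ k ∂μ = raney r k 1 := fun k => by
    obtain ⟨h1, h2⟩ := lintegral_pow_of_cdf hr hρinv' (hV0 0 le_rfl) hV1' hV2 hμ k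
    rw [integral_eq_lintegral_of_nonneg_ae
      (hsupp.mono fun x hx => pow_nonneg hx.1 k) (by fun_prop), h2, ENNReal.toReal_ofReal h1]
  set l := List.ofFn ν with hl
  have hlen : l.length = r := List.length_ofFn
  set S : ℕ → Multiset ℝ := fun n =>
    (∑ k ∈ Finset.range (n + 1), C (hypCoeff l n k) * X ^ k).roots with hS
  have hμS : ∀ n, μn n = ((n : ℝ≥0∞))⁻¹ • ((S n).map Measure.dirac).sum := by
    intro n
    have hprod : ∀ k : ℕ, (l.map fun a => ((k + a).factorial : ℝ)).prod =
        ∏ j, ((k + ν j).factorial : ℝ) := fun k => by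
      rw [hl, List.map_ofFn, List.prod_ofFn]
      rfl
    rw [hμn, hF]
    simp only [hS, sum_hypCoeff_eq_comp, hlen, hprod]
  have hintegral : ∀ (h : ℝ → ℝ) (n : ℕ),
      ∫ x, h x ∂(μn n) = (n : ℝ)⁻¹ * ((S n).map h).sum := fun h n => by
    rw [hμS, integral_smul_measure, (integral_sum_dirac _ h).2]
    simp
  refine tendsto_integral_of_tendsto_moments hM hsupp ?_ ?_ fun k => ?_
  · filter_upwards [eventually_ne_atTop 0] with n hn
    refine ⟨?_⟩
    rw [hμS, Measure.smul_apply, sum_dirac_univ, hS, card_roots_sum_hypCoeff, smul_eq_mul]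
    exact ENNReal.inv_mul_cancel (by exact_mod_cast hn) (ENNReal.natCast_ne_top n)
  · filter_upwards [eventually_ne_atTop 0] with n hn k
    rw [hμS]
    exact (integral_sum_dirac _ _).1.smul_measure (ENNReal.inv_ne_top.2 (by exact_mod_cast hn))
  · simp only [hintegral, hmoment]
    have h := tendsto_power_sums (l := l) (hypCoeff_self_ne_zero l)
      (fun n k hk => hypCoeff_succ l hk) (splits_sum_hypCoeff l) k
    rwa [hlen] at h
end

section
/- For every φ ∈ (0, π/(r+1)), the function V is differentiable at the point x = ρ(φ) and its derivative there equals (sin φ)² (sin(rφ))^{r−1} / ( π (sin((r+1)φ))^r ). -/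
open Real

lemma sin_pos_of_mem_Ioo_pi_div {r : ℕ} (hr : 1 ≤ r) {φ : ℝ}
    (hφ : φ ∈ Set.Ioo 0 (π / ((r : ℝ) + 1))) :
    0 < Real.sin φ ∧ 0 < Real.sin ((r : ℝ) * φ) ∧ 0 < Real.sin (((r : ℝ) + 1) * φ) := by
  obtain ⟨h0, h1⟩ := hφ
  have hr' : (1 : ℝ) ≤ r := by exact_mod_cast hr
  rw [lt_div_iff₀ (by positivity)] at h1
  refine ⟨sin_pos_of_pos_of_lt_pi h0 ?_, sin_pos_of_pos_of_lt_pi (by positivity) ?_,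
    sin_pos_of_pos_of_lt_pi (by positivity) ?_⟩ <;> nlinarith

/-- The function `ρ` has values below `(r+1)^{r+1}/r^r`, by strict concavity of the sine. -/
lemma sin_pow_div_lt {r : ℕ} (hr : 1 ≤ r) {φ : ℝ}
    (hφ : φ ∈ Set.Ioo 0 (π / ((r : ℝ) + 1))) :
    Real.sin (((r : ℝ) + 1) * φ) ^ (r + 1) / (Real.sin φ * Real.sin ((r : ℝ) * φ) ^ r) <
      ((r : ℝ) + 1) ^ (r + 1) / (r : ℝ) ^ r := by
  obtain ⟨ha, hb, hc⟩ := sin_pos_of_mem_Ioo_pi_div hr hφ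
  obtain ⟨h0, h1⟩ := hφ
  have hr0 : (0 : ℝ) < r := by exact_mod_cast hr
  rw [lt_div_iff₀ (by positivity)] at h1
  have hx : ((r : ℝ) + 1) * φ ∈ Set.Icc 0 π := ⟨by positivity, by linarith⟩
  have hz : (0 : ℝ) ∈ Set.Icc 0 π := ⟨le_rfl, pi_pos.le⟩
  have hne : (0 : ℝ) ≠ ((r : ℝ) + 1) * φ := by positivity
  have hs : (r : ℝ) / (r + 1) + 1 / (r + 1) = 1 := by field_simp
  have h2 := strictConcaveOn_sin_Icc.2 hz hx hne
    (show 0 < (r : ℝ) / (r + 1) by positivity) (show 0 < 1 / ((r : ℝ) + 1) by positivity) hs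
  have h3 := strictConcaveOn_sin_Icc.2 hz hx hne
    (show 0 < 1 / ((r : ℝ) + 1) by positivity) (show 0 < (r : ℝ) / (r + 1) by positivity)
    (by rw [add_comm, hs])
  have e2 : 1 / ((r : ℝ) + 1) * ((r + 1) * φ) = φ := by field_simp
  have e3 : (r : ℝ) / ((r : ℝ) + 1) * ((r + 1) * φ) = r * φ := by field_simp
  simp only [smul_eq_mul, mul_zero, zero_add, sin_zero, e2, e3] at h2 h3
  set c := Real.sin (((r : ℝ) + 1) * φ)
  rw [div_lt_iff₀ (by positivity)]
  calc c ^ (r + 1)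
      = ((r : ℝ) + 1) ^ (r + 1) / (r : ℝ) ^ r *
          (1 / ((r : ℝ) + 1) * c * ((r : ℝ) / (r + 1) * c) ^ r) := by
        rw [mul_pow, div_pow]; field_simp; ring
    _ < _ := by
        have := pow_le_pow_left₀ (by positivity) h3.le r
        gcongr

/-- The derivative of `ρ`. -/
lemma hasStrictDerivAt_sin_pow_div {r : ℕ} (hr : 1 ≤ r) {φ : ℝ}
    (hφ : φ ∈ Set.Ioo 0 (π / ((r : ℝ) + 1))) :
    HasStrictDerivAt (fun φ : ℝ ↦ Real.sin (((r : ℝ) + 1) * φ) ^ (r + 1) /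
        (Real.sin φ * Real.sin ((r : ℝ) * φ) ^ r))
      (-(Real.sin (((r : ℝ) + 1) * φ) ^ r *
        ((Real.cos φ * Real.sin (r * φ) - r * Real.sin φ * Real.cos (r * φ)) ^ 2 +
          ((r : ℝ) + 1) ^ 2 * Real.sin φ ^ 2 * Real.sin (r * φ) ^ 2) /
        (Real.sin φ ^ 2 * Real.sin (r * φ) ^ (r + 1)))) φ := by
  obtain ⟨ha, hb, hc⟩ := sin_pos_of_mem_Ioo_pi_div hr hφ
  have hsin (k : ℝ) : HasStrictDerivAt (fun x : ℝ ↦ Real.sin (k * x))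
      (Real.cos (k * φ) * k) φ := by
    simpa using ((hasStrictDerivAt_id φ).const_mul k).sin
  have h := ((hsin (r + 1)).fun_pow (r + 1)).fun_div
    ((hasStrictDerivAt_sin φ).fun_mul ((hsin r).fun_pow r)) (by positivity)
  refine h.congr_deriv ?_
  obtain ⟨n, rfl⟩ : ∃ n, r = n + 1 := ⟨r - 1, by omega⟩
  have hS : Real.sin ((((n + 1 : ℕ) : ℝ) + 1) * φ) =
      Real.sin (((n + 1 : ℕ) : ℝ) * φ) * Real.cos φ +
        Real.cos (((n + 1 : ℕ) : ℝ) * φ) * Real.sin φ := by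
    rw [add_one_mul, sin_add]
  have hC : Real.cos ((((n + 1 : ℕ) : ℝ) + 1) * φ) =
      Real.cos (((n + 1 : ℕ) : ℝ) * φ) * Real.cos φ -
        Real.sin (((n + 1 : ℕ) : ℝ) * φ) * Real.sin φ := by
    rw [add_one_mul, cos_add]
  have hA := Real.sin_sq_add_cos_sq φ
  have hB := Real.sin_sq_add_cos_sq (((n + 1 : ℕ) : ℝ) * φ)
  simp only [Nat.add_sub_cancel]
  rw [hC]
  generalize Real.sin ((((n + 1 : ℕ) : ℝ) + 1) * φ) = c at *
  generalize Real.sin (((n + 1 : ℕ) : ℝ) * φ) = b at *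
  generalize Real.cos (((n + 1 : ℕ) : ℝ) * φ) = B at *
  generalize Real.sin φ = a at *
  generalize Real.cos φ = A at *
  push_cast
  generalize (n : ℝ) = t
  rw [← neg_div, div_eq_div_iff (by positivity) (by positivity)]
  have key : (t + 1 + 1) ^ 2 * (B * A - b * a) * a * b - c * (A * b + (t + 1) ^ 2 * a * B) =
      -((A * b - (t + 1) * a * B) ^ 2 + (t + 1 + 1) ^ 2 * a ^ 2 * b ^ 2) := by
    rw [hS]; ring
  linear_combination (c ^ (n + 1) * b ^ n * (a ^ 2 * b ^ (n + 1 + 1))) * key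

/-- The derivative of `f`. -/
lemma hasDerivAt_sub_sin_div {r : ℕ} (hr : 1 ≤ r) {φ : ℝ}
    (hφ : φ ∈ Set.Ioo 0 (π / ((r : ℝ) + 1))) :
    HasDerivAt (fun φ : ℝ ↦ ((r : ℝ) + 1) * φ -
        (r : ℝ) * (Real.sin (((r : ℝ) + 1) * φ) / Real.sin ((r : ℝ) * φ)) * Real.sin φ)
      (((Real.cos φ * Real.sin (r * φ) - r * Real.sin φ * Real.cos (r * φ)) ^ 2 +
          ((r : ℝ) + 1) ^ 2 * Real.sin φ ^ 2 * Real.sin (r * φ) ^ 2) /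
        Real.sin (r * φ) ^ 2) φ := by
  obtain ⟨ha, hb, hc⟩ := sin_pos_of_mem_Ioo_pi_div hr hφ
  have hsin (k : ℝ) : HasDerivAt (fun x : ℝ ↦ Real.sin (k * x))
      (Real.cos (k * φ) * k) φ := by
    simpa using ((hasDerivAt_id φ).const_mul k).sin
  have h := ((hasDerivAt_id' φ).const_mul ((r : ℝ) + 1)).fun_sub
    ((((hsin (r + 1)).fun_div (hsin r) hb.ne').const_mul (r : ℝ)).fun_mul (hasDerivAt_sin φ))
  refine h.congr_deriv ?_
  have hA := Real.sin_sq_add_cos_sq φ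
  rw [add_one_mul (r : ℝ) φ, sin_add, cos_add]
  generalize Real.sin ((r : ℝ) * φ) = b at *
  generalize Real.cos ((r : ℝ) * φ) = B at *
  generalize Real.sin φ = a at *
  generalize Real.cos φ = A at *
  field_simp
  linear_combination (-((r : ℝ) + 1) * b ^ 2) * hA

lemma strictAntiOn_sin_pow_div {r : ℕ} (hr : 1 ≤ r) :
    StrictAntiOn (fun φ : ℝ ↦ Real.sin (((r : ℝ) + 1) * φ) ^ (r + 1) /
        (Real.sin φ * Real.sin ((r : ℝ) * φ) ^ r)) (Set.Ioo 0 (π / ((r : ℝ) + 1))) := by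
  refine strictAntiOn_of_deriv_neg (convex_Ioo _ _)
    (fun x hx ↦ (hasStrictDerivAt_sin_pow_div hr hx).hasDerivAt.continuousAt.continuousWithinAt)
    fun x hx ↦ ?_
  rw [interior_Ioo] at hx
  obtain ⟨ha, hb, hc⟩ := sin_pos_of_mem_Ioo_pi_div hr hx
  rw [(hasStrictDerivAt_sin_pow_div hr hx).hasDerivAt.deriv, neg_lt_zero]
  positivity



/-- The distribution function `V` is differentiable at `ρ(φ)` with derivative
`sin²φ (sin rφ)^{r−1} / (π (sin(r+1)φ)^r)` (the Fuss–Catalan density). -/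
theorem stmt_11 (r : ℕ) (hr : 1 ≤ r)
    (ρ f : ℝ → ℝ)
    (hρ : ∀ φ, ρ φ = Real.sin (((r : ℝ) + 1) * φ) ^ (r + 1) /
      (Real.sin φ * Real.sin ((r : ℝ) * φ) ^ r))
    (hf : ∀ φ, f φ = ((r : ℝ) + 1) * φ -
      (r : ℝ) * (Real.sin (((r : ℝ) + 1) * φ) / Real.sin ((r : ℝ) * φ)) * Real.sin φ)
    (ρinv : ℝ → ℝ)
    (hρinv : ∀ x ∈ Set.Ioo (0 : ℝ) (((r : ℝ) + 1) ^ (r + 1) / (r : ℝ) ^ r),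
      ρinv x ∈ Set.Ioo 0 (π / ((r : ℝ) + 1)) ∧ ρ (ρinv x) = x)
    (V : ℝ → ℝ)
    (hV0 : ∀ x : ℝ, x ≤ 0 → V x = 0)
    (hV1 : ∀ x : ℝ, 0 < x → x < ((r : ℝ) + 1) ^ (r + 1) / (r : ℝ) ^ r →
      V x = 1 - (1 / π) * f (ρinv x))
    (hV2 : ∀ x : ℝ, ((r : ℝ) + 1) ^ (r + 1) / (r : ℝ) ^ r ≤ x → V x = 1)
    (φ : ℝ) (hφ1 : 0 < φ) (hφ2 : φ < π / ((r : ℝ) + 1)) :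
    HasDerivAt V
      (Real.sin φ ^ 2 * Real.sin ((r : ℝ) * φ) ^ (r - 1) /
        (π * Real.sin (((r : ℝ) + 1) * φ) ^ r)) (ρ φ) := by
  obtain rfl : ρ = _ := funext hρ
  obtain rfl : f = _ := funext hf
  have hφ : φ ∈ Set.Ioo 0 (π / ((r : ℝ) + 1)) := ⟨hφ1, hφ2⟩
  have hmem : ∀ x ∈ Set.Ioo 0 (π / ((r : ℝ) + 1)),
      Real.sin (((r : ℝ) + 1) * x) ^ (r + 1) / (Real.sin x * Real.sin ((r : ℝ) * x) ^ r) ∈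
        Set.Ioo 0 (((r : ℝ) + 1) ^ (r + 1) / (r : ℝ) ^ r) := fun x hx ↦ by
    obtain ⟨ha, hb, hc⟩ := sin_pos_of_mem_Ioo_pi_div hr hx
    exact ⟨by positivity, sin_pow_div_lt hr hx⟩
  have hleft : ∀ x ∈ Set.Ioo 0 (π / ((r : ℝ) + 1)),
      ρinv (Real.sin (((r : ℝ) + 1) * x) ^ (r + 1) /
        (Real.sin x * Real.sin ((r : ℝ) * x) ^ r)) = x := fun x hx ↦
    (strictAntiOn_sin_pow_div hr).injOn (hρinv _ (hmem x hx)).1 hx (hρinv _ (hmem x hx)).2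
  obtain ⟨ha, hb, hc⟩ := sin_pos_of_mem_Ioo_pi_div hr hφ
  have hinv := (hasStrictDerivAt_sin_pow_div hr hφ).to_local_left_inverse
    (neg_ne_zero.2 (by positivity)) (Filter.eventually_of_mem (Ioo_mem_nhds hφ1 hφ2) hleft)
  have hfd := hasDerivAt_sub_sin_div hr hφ
  rw [← hleft φ hφ] at hfd
  have hV := ((hfd.comp _ hinv.hasDerivAt).const_mul (1 / π)).const_sub 1
  rw [hleft φ hφ] at hV
  refine (hV.congr_of_eventuallyEq ?_).congr_deriv ?_
  · filter_upwards [Ioo_mem_nhds (hmem φ hφ).1 (hmem φ hφ).2] with x hx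
    exact hV1 x hx.1 hx.2
  · obtain ⟨n, rfl⟩ : ∃ n, r = n + 1 := ⟨r - 1, by omega⟩
    have hD : 0 < (Real.cos φ * Real.sin (((n + 1 : ℕ) : ℝ) * φ) -
          ((n + 1 : ℕ) : ℝ) * Real.sin φ * Real.cos (((n + 1 : ℕ) : ℝ) * φ)) ^ 2 +
        (((n + 1 : ℕ) : ℝ) + 1) ^ 2 * Real.sin φ ^ 2 *
          Real.sin (((n + 1 : ℕ) : ℝ) * φ) ^ 2 := by positivity
    generalize (Real.cos φ * _ - _) ^ 2 + _ = D at hD ⊢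
    rw [Nat.add_sub_cancel, inv_neg, inv_div]
    field_simp
    ring
end

section
/- For every nonnegative integer n, (1/π) ∫_0^{π/(r+1)} ρ(φ)^n f'(φ) dφ = binom((r+1)n, n) / (rn + 1), i.e. the n-th moment of the probability distribution with distribution function V equals the n-th Fuss–Catalan number of order r. -/
open Real

open MeasureTheory Set

theorem intervalIntegrable_im_zpow_mul {γ γ' : ℝ → ℂ} {a b : ℝ}
    (hγ : ContinuousOn γ (uIcc a b)) (hγ' : ContinuousOn γ' (uIcc a b))
    (h0 : ∀ x ∈ uIcc a b, γ x ≠ 0) (m : ℤ) :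
    IntervalIntegrable (fun x => (γ x ^ m * γ' x).im) volume a b :=
  (Complex.continuous_im.comp_continuousOn
    ((hγ.zpow₀ m fun x hx => Or.inl (h0 x hx)).mul hγ')).intervalIntegrable

/-- Along a path avoiding the origin with real endpoints, the imaginary part of `∫ z ^ m dz`
vanishes for `m ≠ -1`. -/
theorem integral_im_zpow_mul_deriv_eq_zero {γ γ' : ℝ → ℂ} {a b : ℝ}
    (hγ : ∀ x ∈ uIcc a b, HasDerivAt γ (γ' x) x) (hγ' : ContinuousOn γ' (uIcc a b))
    (h0 : ∀ x ∈ uIcc a b, γ x ≠ 0) (ha : (γ a).im = 0) (hb : (γ b).im = 0)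
    {m : ℤ} (hm : m ≠ -1) : ∫ x in a..b, (γ x ^ m * γ' x).im = 0 := by
  have hm1 : ((m + 1 : ℤ) : ℂ) ≠ 0 := by
    rw [Int.cast_ne_zero]
    omega
  have him : ∀ z : ℂ, z.im = 0 → (z ^ (m + 1) / ((m + 1 : ℤ) : ℂ)).im = 0 := by
    intro z hz
    have hz' : z = (z.re : ℂ) := Complex.ext rfl (by simpa using hz)
    rw [hz']
    exact_mod_cast Complex.ofReal_im (z.re ^ (m + 1) / ((m + 1 : ℤ) : ℝ))
  have hd : ∀ x ∈ uIcc a b, HasDerivAt (fun x => (γ x ^ (m + 1) / ((m + 1 : ℤ) : ℂ)).im)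
      (γ x ^ m * γ' x).im x := by
    intro x hx
    have h1 : HasDerivAt (fun x => γ x ^ (m + 1) / ((m + 1 : ℤ) : ℂ)) (γ x ^ m * γ' x) x := by
      refine (((hasDerivAt_zpow (m + 1) (γ x) (Or.inl (h0 x hx))).comp x (hγ x hx)).div_const
        ((m + 1 : ℤ) : ℂ)).congr_deriv ?_
      rw [add_sub_cancel_right]
      field_simp
    exact Complex.imCLM.hasFDerivAt.comp_hasDerivAt x h1
  rw [intervalIntegral.integral_eq_sub_of_hasDerivAt hd (intervalIntegrable_im_zpow_mul
    (fun x hx => (hγ x hx).continuousAt.continuousWithinAt) hγ' h0 m), him _ ha, him _ hb, sub_zero]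

theorem choose_sub_mul_choose_eq_fussCatalan (r n : ℕ) :
    (((r + 1) * (n + 1)).choose (n + 1) : ℝ) - r * ((r + 1) * (n + 1)).choose n =
      (((r + 1) * (n + 1)).choose (n + 1) : ℝ) / (r * (n + 1 : ℕ) + 1) := by
  have h := Nat.choose_succ_right_eq ((r + 1) * (n + 1)) n
  have hs : (r + 1) * (n + 1) - n = r * (n + 1) + 1 := by
    rw [Nat.sub_eq_iff_eq_add (by nlinarith)]
    ring
  rw [hs] at h
  have h' : (((r + 1) * (n + 1)).choose (n + 1) : ℝ) * (n + 1) =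
      ((r + 1) * (n + 1)).choose n * (r * (n + 1) + 1) := by exact_mod_cast h
  have : (r : ℝ) * (n + 1 : ℕ) + 1 ≠ 0 := by positivity
  rw [eq_div_iff this]
  push_cast
  linear_combination (r : ℝ) * h'

theorem one_add_pow_div_pow_mul (r n : ℕ) {u : ℂ} (hu : u ≠ 0) (d : ℂ) :
    ((1 + u) ^ (r + 1) / u) ^ n * ((u⁻¹ - r) * d) =
      ∑ k ∈ Finset.range ((r + 1) * n + 1), ((((r + 1) * n).choose k : ℝ) : ℂ) *
        (u ^ ((k : ℤ) - n - 1) * d - (r : ℝ) * (u ^ ((k : ℤ) - n) * d)) := by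
  rw [div_pow, ← pow_mul, add_comm 1 u, add_pow, Finset.sum_div, Finset.sum_mul]
  refine Finset.sum_congr rfl fun k _ => ?_
  rw [zpow_sub₀ hu, zpow_sub₀ hu, zpow_natCast, zpow_natCast, zpow_one, one_pow]
  push_cast
  field_simp

/-- A path with real endpoints avoiding the origin, whose argument increases by `π`, computes the
Fuss–Catalan numbers as residues. -/
theorem integral_im_eq_fussCatalan (r n : ℕ) {u u' : ℝ → ℂ} {a b : ℝ}
    (hu : ∀ x ∈ uIcc a b, HasDerivAt u (u' x) x) (hu' : ContinuousOn u' (uIcc a b))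
    (h0 : ∀ x ∈ uIcc a b, u x ≠ 0) (ha : (u a).im = 0) (hb : (u b).im = 0)
    (hπ : ∫ x in a..b, (u x ^ (-1 : ℤ) * u' x).im = π) :
    ∫ x in a..b, (((1 + u x) ^ (r + 1) / u x) ^ n * (((u x)⁻¹ - r) * u' x)).im =
      π * ((((r + 1) * n).choose n : ℝ) / (r * n + 1)) := by
  have hI := intervalIntegrable_im_zpow_mul
    (fun x hx => (hu x hx).continuousAt.continuousWithinAt) hu' h0
  have hval : ∀ m : ℤ, ∫ x in a..b, (u x ^ m * u' x).im = if m = -1 then π else 0 := by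
    intro m
    split_ifs with hm
    · rw [hm, hπ]
    · exact integral_im_zpow_mul_deriv_eq_zero hu hu' h0 ha hb hm
  have hcongr : ∀ x ∈ uIcc a b,
      (((1 + u x) ^ (r + 1) / u x) ^ n * (((u x)⁻¹ - r) * u' x)).im =
      ∑ k ∈ Finset.range ((r + 1) * n + 1), (((r + 1) * n).choose k : ℝ) *
        ((u x ^ ((k : ℤ) - n - 1) * u' x).im - (r : ℝ) * (u x ^ ((k : ℤ) - n) * u' x).im) := by
    intro x hx
    rw [one_add_pow_div_pow_mul r n (h0 x hx), Complex.im_sum]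
    simp only [Complex.im_ofReal_mul, Complex.sub_im]
  rw [intervalIntegral.integral_congr hcongr, intervalIntegral.integral_finsetSum
    fun k _ => ((hI _).sub ((hI _).const_mul _)).const_mul _]
  have hterm : ∀ k : ℕ, ∫ x in a..b, (((r + 1) * n).choose k : ℝ) *
        ((u x ^ ((k : ℤ) - n - 1) * u' x).im - (r : ℝ) * (u x ^ ((k : ℤ) - n) * u' x).im) =
      (if k = n then (((r + 1) * n).choose k : ℝ) * π else 0) -
        (if k + 1 = n then (((r + 1) * n).choose k : ℝ) * (r * π) else 0) := by
    intro k
    rw [intervalIntegral.integral_const_mul, intervalIntegral.integral_sub (hI _)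
      ((hI _).const_mul _), intervalIntegral.integral_const_mul, hval, hval]
    have e1 : ((k : ℤ) - n - 1 = -1) ↔ k = n := by omega
    have e2 : ((k : ℤ) - n = -1) ↔ k + 1 = n := by omega
    simp only [e1, e2]
    split_ifs <;> ring
  simp only [hterm, Finset.sum_sub_distrib]
  have hn : n ∈ Finset.range ((r + 1) * n + 1) := by
    rw [Finset.mem_range]
    nlinarith
  rw [Finset.sum_ite_eq' _ n, if_pos hn]
  cases n with
  | zero => simp
  | succ n =>
    have hn' : n ∈ Finset.range ((r + 1) * (n + 1) + 1) := by
      rw [Finset.mem_range] at hn ⊢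
      omega
    simp only [add_left_inj]
    rw [Finset.sum_ite_eq' _ n, if_pos hn', ← choose_sub_mul_choose_eq_fussCatalan]
    ring

/-- `sin (r x) / sin x` extends to a continuously differentiable function. -/
theorem exists_hasDerivAt_mul_sin_eq_sin_mul (r : ℕ) :
    ∃ P P' : ℝ → ℝ, (∀ x, HasDerivAt P (P' x) x) ∧ Continuous P' ∧ P 0 = r ∧
      ∀ x, P x * sin x = sin (r * x) := by
  refine ⟨fun x => (Polynomial.Chebyshev.U ℝ ((r : ℤ) - 1)).eval (cos x),
    fun x => (Polynomial.Chebyshev.U ℝ ((r : ℤ) - 1)).derivative.eval (cos x) * (-sin x),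
    fun x => ?_, by fun_prop, ?_, fun x => ?_⟩
  · exact ((Polynomial.Chebyshev.U ℝ ((r : ℤ) - 1)).hasDerivAt (cos x)).comp x (hasDerivAt_cos x)
  · simp [Polynomial.Chebyshev.U_eval_one]
  · simp [Polynomial.Chebyshev.U_real_cos]

theorem sin_add_mul_exp_eq (x y : ℝ) :
    (sin (x + y) : ℂ) * Complex.exp (y * Complex.I) =
      sin x + sin y * Complex.exp ((x + y : ℝ) * Complex.I) := by
  rw [Complex.exp_mul_I, Complex.exp_mul_I]
  simp only [← Complex.ofReal_cos, ← Complex.ofReal_sin, sin_add, cos_add]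
  have h : (sin y : ℂ) ^ 2 + (cos y : ℂ) ^ 2 = 1 := by exact_mod_cast sin_sq_add_cos_sq y
  push_cast [sin_add, cos_add]
  simp only [← Complex.ofReal_cos, ← Complex.ofReal_sin]
  linear_combination (sin x : ℂ) * h

/-- The `n`-th moment of the distribution with distribution function `V` equals
the `n`-th Fuss–Catalan number of order `r`:
`(1/π) ∫_0^{π/(r+1)} ρ(φ)^n f'(φ) dφ = binom((r+1)n, n)/(rn+1)`. -/
theorem stmt_12 (r : ℕ) (hr : 1 ≤ r) (n : ℕ)
    (ρ f : ℝ → ℝ)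
    (hρ : ∀ φ, ρ φ = Real.sin (((r : ℝ) + 1) * φ) ^ (r + 1) /
      (Real.sin φ * Real.sin ((r : ℝ) * φ) ^ r))
    (hf : ∀ φ, f φ = ((r : ℝ) + 1) * φ -
      (r : ℝ) * (Real.sin (((r : ℝ) + 1) * φ) / Real.sin ((r : ℝ) * φ)) * Real.sin φ) :
    (1 / π) * ∫ φ in (0 : ℝ)..(π / ((r : ℝ) + 1)), ρ φ ^ n * deriv f φ =
      (Nat.choose ((r + 1) * n) n : ℝ) / ((r : ℝ) * (n : ℝ) + 1) := by
  obtain ⟨P, P', hP, hP', hP0, hPs⟩ := exists_hasDerivAt_mul_sin_eq_sin_mul r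
  have hr1 : (1 : ℝ) ≤ r := by exact_mod_cast hr
  have hb : 0 < π / ((r : ℝ) + 1) := by positivity
  have hbr : ((r : ℝ) + 1) * (π / (r + 1)) = π := by field_simp
  have hsin : ∀ x ∈ Ioc 0 (π / ((r : ℝ) + 1)), 0 < sin x ∧ 0 < sin (r * x) := by
    intro x hx
    have h1 : ((r : ℝ) + 1) * x ≤ π := hbr ▸ mul_le_mul_of_nonneg_left hx.2 (by positivity)
    have h2 := hx.1
    exact ⟨sin_pos_of_pos_of_lt_pi h2 (by nlinarith),
      sin_pos_of_pos_of_lt_pi (by positivity) (by nlinarith)⟩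
  have hPne : ∀ x ∈ uIcc 0 (π / ((r : ℝ) + 1)), P x ≠ 0 := by
    intro x hx
    rw [uIcc_of_le hb.le] at hx
    rcases hx.1.eq_or_lt with h | h
    · rw [← h, hP0]
      positivity
    · intro h0
      have := hPs x
      rw [h0, zero_mul] at this
      exact (hsin x ⟨h, hx.2⟩).2.ne this
  set u : ℝ → ℂ := fun x => Complex.exp (((r + 1 : ℝ) * x : ℝ) * Complex.I) / P x with hu_def
  set u' : ℝ → ℂ := fun x => u x * ((r + 1 : ℝ) * Complex.I - (P' x / P x : ℝ)) with hu'_def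
  have hu : ∀ x, P x ≠ 0 → HasDerivAt u (u' x) x := by
    intro x hx
    have hx' : (P x : ℂ) ≠ 0 := by exact_mod_cast hx
    have h1 : HasDerivAt (fun x : ℝ => (((r + 1 : ℝ) * x : ℝ) : ℂ) * Complex.I)
        ((r + 1 : ℝ) * Complex.I) x := by
      simpa using (((hasDerivAt_id x).const_mul (r + 1 : ℝ)).ofReal_comp).mul_const Complex.I
    refine (h1.cexp.div (hP x).ofReal_comp hx').congr_deriv ?_
    simp only [hu'_def, hu_def]
    push_cast
    field_simp
  have hu0 : ∀ x ∈ uIcc 0 (π / ((r : ℝ) + 1)), u x ≠ 0 := fun x hx =>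
    div_ne_zero (Complex.exp_ne_zero _) (Complex.ofReal_ne_zero.mpr (hPne x hx))
  have hPc : Continuous P := continuous_iff_continuousAt.mpr fun x => (hP x).continuousAt
  have hu'c : ContinuousOn u' (uIcc 0 (π / ((r : ℝ) + 1))) := by
    refine ContinuousOn.mul (fun x hx => (hu x (hPne x hx)).continuousAt.continuousWithinAt)
      (continuousOn_const.sub (Complex.continuous_ofReal.comp_continuousOn ?_))
    exact hP'.continuousOn.div hPc.continuousOn hPne
  have hlog : ∀ x ∈ uIcc 0 (π / ((r : ℝ) + 1)), (u x ^ (-1 : ℤ) * u' x).im = r + 1 := by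
    intro x hx
    rw [zpow_neg_one, hu'_def, inv_mul_cancel_left₀ (hu0 x hx), Complex.sub_im,
      Complex.ofReal_im, Complex.im_ofReal_mul, Complex.I_im]
    ring
  have hu_im : ∀ x, (u x).im = sin ((r + 1) * x) / P x := by
    intro x
    rw [hu_def, Complex.div_ofReal_im, Complex.exp_ofReal_mul_I_im]
  have key := integral_im_eq_fussCatalan r n (fun x hx => hu x (hPne x hx)) hu'c hu0
    (by simp [hu_im]) (by rw [hu_im, hbr, sin_pi, zero_div])
    (by rw [intervalIntegral.integral_congr hlog, intervalIntegral.integral_const, sub_zero,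
          smul_eq_mul, mul_comm, hbr])
  rw [one_div, inv_mul_eq_iff_eq_mul₀ pi_ne_zero, ← key]
  refine intervalIntegral.integral_congr_Ioo_of_le hb.le fun x hx => ?_
  have hxI : x ∈ uIcc 0 (π / ((r : ℝ) + 1)) := by
    rw [uIcc_of_le hb.le]
    exact Ioo_subset_Icc_self hx
  obtain ⟨hs, hrs⟩ := hsin x (Ioo_subset_Ioc_self hx)
  have hPx := hPne x hxI
  have hderiv : HasDerivAt f ((r + 1) - r * (u' x).im) x := by
    have h1 : HasDerivAt (fun y => ((r : ℝ) + 1) * y - r * (u y).im)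
        ((r + 1) - r * (u' x).im) x := by
      have h2 : HasDerivAt (fun y => (u y).im) (u' x).im x :=
        Complex.imCLM.hasFDerivAt.comp_hasDerivAt x (hu x hPx)
      exact (((hasDerivAt_id x).const_mul ((r : ℝ) + 1)).sub (h2.const_mul (r : ℝ))).congr_deriv
        (by rw [mul_one])
    refine h1.congr_of_eventuallyEq ?_
    filter_upwards [continuous_sin.continuousAt.eventually_ne hs.ne'] with y hy
    rw [hf, hu_im, ← hPs]
    field_simp
  have hρu : (1 + u x) ^ (r + 1) / u x = (ρ x : ℂ) := by
    have hsC : (sin x : ℂ) ≠ 0 := by exact_mod_cast hs.ne'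
    have hrsC : (sin (r * x) : ℂ) ≠ 0 := by exact_mod_cast hrs.ne'
    have hPx' : (P x : ℂ) = sin (r * x) / sin x := by
      rw [eq_div_iff hsC]
      exact_mod_cast hPs x
    have hux : u x = sin x * Complex.exp (x * Complex.I) ^ (r + 1) / sin (r * x) := by
      rw [hu_def]
      simp only
      rw [hPx', ← Complex.exp_nat_mul]
      push_cast
      rw [← mul_assoc]
      field_simp
    have hw : 1 + u x = sin ((r + 1) * x) * Complex.exp (x * Complex.I) / sin (r * x) := by
      have h := sin_add_mul_exp_eq (r * x) x
      rw [show (r : ℝ) * x + x = (r + 1) * x by ring] at h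
      rw [h, hu_def]
      simp only
      rw [hPx']
      field_simp
    have hE := Complex.exp_ne_zero (x * Complex.I)
    rw [hw, hux, hρ]
    push_cast [-Complex.ofReal_sin]
    rw [div_pow, mul_pow, pow_succ (sin (r * x) : ℂ)]
    field_simp
  rw [hρu, hderiv.deriv, ← Complex.ofReal_pow, Complex.im_ofReal_mul, sub_mul, Complex.sub_im,
    ← zpow_neg_one, hlog x hxI, ← Complex.ofReal_natCast r, Complex.im_ofReal_mul]
end
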